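/- arXiv:2305.19850 — 15 statements merged into one kernel-verified Lean document; each statement's English description precedes it below -/
import Mathlib

section
/- Let K be any field and let n ≥ 1. In the field of fractions of the polynomial ring K[x_1,…,x_n], the subfield generated by K together with the elementary symmetric polynomials e_1,…,e_n equals the subfield generated by K together with all power sum polynomials p_k for k ≥ 1. -/
open MvPolynomial

/-- The Hankel matrix of the power sums of distinct nonzero elements is nonsingular. -/
theorem det_hankel_powerSum_ne_zero {F : Type*} [Field F] {n : ℕ} {x : Fin n → F}
    (hx : Function.Injective x) (hx0 : ∀ i, x i ≠ 0) :
    (Matrix.of fun i j : Fin n => ∑ l, x l ^ ((i : ℕ) + j + 1)).det ≠ 0 := by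
  have h : (Matrix.of fun i j : Fin n => ∑ l, x l ^ ((i : ℕ) + j + 1)) =
      (Matrix.vandermonde x).transpose * Matrix.diagonal x * Matrix.vandermonde x := by
    ext i j
    rw [Matrix.mul_apply]
    simp only [Matrix.of_apply, Matrix.mul_diagonal, Matrix.transpose_apply,
      Matrix.vandermonde_apply]
    exact Finset.sum_congr rfl fun l _ => by ring
  rw [h, Matrix.det_mul, Matrix.det_mul, Matrix.det_transpose, Matrix.det_diagonal]
  have hv := Matrix.det_vandermonde_ne_zero_iff.2 hx
  exact mul_ne_zero (mul_ne_zero hv (Finset.prod_ne_zero_iff.2 fun i _ => hx0 i)) hv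

/-- If a subfield contains the power sums of distinct nonzero elements, then it contains the
coefficients of the monic polynomial having these elements as roots. -/
theorem Subfield.coeff_mem_of_powerSum_mem {F : Type*} [Field F] (L : Subfield F) {n : ℕ}
    {x : Fin n → F} (hx : Function.Injective x) (hx0 : ∀ i, x i ≠ 0)
    (hL : ∀ k, ∑ l, x l ^ (k + 1) ∈ L) {c : Fin n → F}
    (hc : ∀ l, ∑ j, c j * x l ^ (j : ℕ) = x l ^ n) (j : Fin n) : c j ∈ L := by
  let p : ℕ → L := fun k => ⟨∑ l, x l ^ (k + 1), hL k⟩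
  let M : Matrix (Fin n) (Fin n) L := Matrix.of fun i j => p (i + j)
  let b : Fin n → L := fun i => p (i + n)
  have hdet : (M.map L.subtype).det ≠ 0 := det_hankel_powerSum_ne_zero hx hx0
  have hM : IsUnit M.det := by
    refine isUnit_iff_ne_zero.2 fun h => hdet ?_
    have := L.subtype.map_det M
    rw [h, map_zero] at this
    exact this.symm
  have hcb : (M.map L.subtype).mulVec c = L.subtype ∘ b := by
    ext i
    change ∑ j : Fin n, (∑ l, x l ^ ((i : ℕ) + j + 1)) * c j = ∑ l, x l ^ ((i : ℕ) + n + 1)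
    simp_rw [Finset.sum_mul]
    rw [Finset.sum_comm]
    refine Finset.sum_congr rfl fun l _ => ?_
    rw [show x l ^ ((i : ℕ) + n + 1) = x l ^ ((i : ℕ) + 1) * x l ^ n by ring, ← hc l,
      Finset.mul_sum]
    exact Finset.sum_congr rfl fun j _ => by ring
  have hsol : (M.map L.subtype).mulVec (L.subtype ∘ (M⁻¹.mulVec b)) = L.subtype ∘ b := by
    ext i
    rw [← RingHom.map_mulVec, Matrix.mulVec_mulVec, Matrix.mul_nonsing_inv M hM,
      Matrix.one_mulVec, Function.comp_apply]
  have heq : c = L.subtype ∘ (M⁻¹.mulVec b) :=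
    Matrix.mulVec_injective_of_isUnit
      ((Matrix.isUnit_iff_isUnit_det _).2 (isUnit_iff_ne_zero.2 hdet)) (hcb.trans hsol.symm)
  rw [heq]
  exact (M⁻¹.mulVec b j).2

/-- Each variable is a root of `∏ i, (T - X i)`, expanded in elementary symmetric polynomials. -/
theorem MvPolynomial.sum_esymm_mul_X_pow (R : Type*) [CommRing R] (n : ℕ) (l : Fin n) :
    ∑ j : Fin n, (-1) ^ (n - j + 1) * esymm (Fin n) R (n - j) * X l ^ (j : ℕ) =
      (X l : MvPolynomial (Fin n) R) ^ n := by
  have h := congrArg (Polynomial.eval (-X l : MvPolynomial (Fin n) R))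
    (MvPolynomial.prod_C_add_X_eq_sum_esymm R (Fin n))
  rw [Polynomial.eval_prod, Finset.prod_eq_zero (Finset.mem_univ l) (by simp),
    Polynomial.eval_finsetSum, Fintype.card_fin, ← Finset.sum_range_reflect,
    Finset.sum_range_succ] at h
  simp only [Polynomial.eval_mul, Polynomial.eval_C, Polynomial.eval_pow, Polynomial.eval_X,
    Nat.add_sub_cancel, Nat.sub_self, Nat.sub_zero, esymm_zero, one_mul] at h
  rw [Finset.sum_range] at h
  have h2 := congrArg (fun t => (-1) ^ n * t) h
  simp only [mul_zero, mul_add, Finset.mul_sum] at h2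
  rw [← mul_pow, neg_one_mul, neg_neg] at h2
  rw [← sub_eq_zero, ← neg_eq_zero, neg_sub, sub_eq_add_neg, ← Finset.sum_neg_distrib, add_comm,
    h2]
  congr 1
  refine Finset.sum_congr rfl fun j _ => ?_
  have hj : n - (n - (j : ℕ)) = j := by omega
  rw [hj, neg_pow (X l : MvPolynomial (Fin n) R)]
  have hs : (-1 : MvPolynomial (Fin n) R) ^ n = (-1) ^ (n - (j : ℕ)) * (-1) ^ (j : ℕ) := by
    rw [← pow_add, Nat.sub_add_cancel j.2.le]
  have hs' : (-1 : MvPolynomial (Fin n) R) ^ (j : ℕ) * (-1) ^ (j : ℕ) = 1 := by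
    rw [← mul_pow]; simp
  rw [hs, pow_succ]
  linear_combination (-(-1) ^ (n - (j : ℕ)) * esymm (Fin n) R (n - j) * X l ^ (j : ℕ)) * hs'

/-- A subring containing the elementary symmetric polynomials contains the power sums. -/
theorem Subring.psum_mem_of_esymm_mem {σ R A : Type*} [Fintype σ] [CommRing R] [CommRing A]
    (f : MvPolynomial σ R →+* A) (S : Subring A)
    (hS : ∀ k, 0 < k → f (esymm σ R k) ∈ S) {k : ℕ} (hk : 0 < k) : f (psum σ R k) ∈ S := by
  induction k using Nat.strong_induction_on with
  | _ k ih =>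
    rw [psum_eq_mul_esymm_sub_sum σ R k hk]
    simp only [map_sub, map_mul, map_pow, map_neg, map_one, map_natCast, map_sum]
    have hneg (m : ℕ) : (-1 : A) ^ m ∈ S := pow_mem (neg_mem (one_mem S)) m
    refine sub_mem (mul_mem (mul_mem (hneg _) (natCast_mem S k)) (hS k hk))
      (sum_mem fun a ha => ?_)
    rw [Finset.mem_filter, Finset.HasAntidiagonal.mem_antidiagonal, Set.mem_Ioo] at ha
    exact mul_mem (mul_mem (hneg _) (hS _ (by omega))) (ih _ (by omega) (by omega))

/-- For any field `K`, inside the fraction field of `K[x_1, …, x_n]`, the subfield generated by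
`K` and the elementary symmetric polynomials `e_1, …, e_n` equals the subfield generated by `K`
and all the power sum polynomials `p_k`, `k ≥ 1`. -/
theorem stmt1 (K : Type*) [Field K] (n : ℕ) (hn : 1 ≤ n) :
    IntermediateField.adjoin K
        ((fun k => algebraMap (MvPolynomial (Fin n) K) (FractionRing (MvPolynomial (Fin n) K))
          (esymm (Fin n) K k)) '' (Set.Icc 1 n)) =
      IntermediateField.adjoin K
        ((fun k => algebraMap (MvPolynomial (Fin n) K) (FractionRing (MvPolynomial (Fin n) K))
          (psum (Fin n) K k)) '' (Set.Ici 1)) := by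
  set f := algebraMap (MvPolynomial (Fin n) K) (FractionRing (MvPolynomial (Fin n) K))
  have hinj : Function.Injective f := IsFractionRing.injective _ _
  apply le_antisymm
  · rw [IntermediateField.adjoin_le_iff]
    rintro _ ⟨k, ⟨hk1, hkn⟩, rfl⟩
    set L := IntermediateField.adjoin K ((fun k => f (psum (Fin n) K k)) '' Set.Ici 1)
    have h := L.toSubfield.coeff_mem_of_powerSum_mem (x := fun l => f (X l))
      (hinj.comp (X_injective (σ := Fin n) (R := K)))
      (fun i => (map_ne_zero_iff f hinj).2 (X_ne_zero i))
      (fun k => by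
        have : f (psum (Fin n) K (k + 1)) ∈ L :=
          IntermediateField.subset_adjoin _ _ ⟨k + 1, by simp, rfl⟩
        simpa [psum] using this)
      (c := fun j => f ((-1) ^ (n - (j : ℕ) + 1) * esymm (Fin n) K (n - j)))
      (fun l => by simpa using congrArg f (sum_esymm_mul_X_pow K n l))
      ⟨n - k, by omega⟩
    have hk : n - (n - k) = k := by omega
    simp only [hk, map_mul, map_pow, map_neg, map_one] at h
    rcases neg_one_pow_eq_or (FractionRing (MvPolynomial (Fin n) K)) (k + 1) with hs | hs
    · simpa [hs] using h
    · simpa [hs] using h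
  · rw [IntermediateField.adjoin_le_iff]
    rintro _ ⟨k, hk, rfl⟩
    refine Subring.psum_mem_of_esymm_mem f
      (IntermediateField.adjoin K _).toSubfield.toSubring (fun m hm => ?_) hk
    rcases le_or_gt m n with hmn | hmn
    · exact IntermediateField.subset_adjoin _ _ ⟨m, ⟨hm, hmn⟩, rfl⟩
    · have h0 : esymm (Fin n) K m = 0 := by
        rw [esymm, Finset.powersetCard_eq_empty.2 (by simpa using hmn), Finset.sum_empty]
      rw [h0, map_zero]
      exact zero_mem _
end

section
/- Let K be a field of positive characteristic r and let the number of variables satisfy n ≥ r. Then, in the field of fractions of K[x_1,…,x_n], the subfield generated by K together with e_1,…,e_n equals the subfield generated by K together with p_1, p_2, …, p_{2n+1−r}. -/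
open MvPolynomial

/-- A square linear system with coefficients and right-hand side in an intermediate field `F` and
nonzero determinant has its solution in `F`. -/
theorem IntermediateField.mem_of_mulVec_mem {K L ι : Type*} [Field K] [Field L] [Algebra K L]
    [Fintype ι] [DecidableEq ι] (F : IntermediateField K L) (M : Matrix ι ι L) (v : ι → L)
    (hM : ∀ i j, M i j ∈ F) (hdet : M.det ≠ 0) (hv : ∀ i, M.mulVec v i ∈ F) (i : ι) :
    v i ∈ F := by
  let N : Matrix ι ι F := Matrix.of fun i j => ⟨M i j, hM i j⟩
  have hNM : N.map (algebraMap F L) = M := rfl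
  let w : ι → F := fun i => ⟨M.mulVec v i, hv i⟩
  have hw : (algebraMap F L) ∘ w = M.mulVec v := rfl
  have hN : IsUnit N.det := by
    refine isUnit_iff_ne_zero.mpr fun h => hdet ?_
    rw [← hNM, ← RingHom.mapMatrix_apply, ← RingHom.map_det, h, map_zero]
  have hsol : (algebraMap F L) ∘ (N⁻¹.mulVec w) = v := by
    have hinj : Function.Injective M.mulVec :=
      Matrix.mulVec_injective_of_isUnit
        ((Matrix.isUnit_iff_isUnit_det M).mpr (isUnit_iff_ne_zero.mpr hdet))
    apply hinj
    rw [← hw]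
    funext k
    have := RingHom.map_mulVec (algebraMap F L) N (N⁻¹.mulVec w) k
    rw [hNM, Matrix.mulVec_mulVec, Matrix.mul_nonsing_inv _ hN, Matrix.one_mulVec] at this
    exact this.symm
  rw [← hsol]
  exact (N⁻¹.mulVec w i).2

namespace MvPolynomial

/-- The Hankel matrix of the power sums `p₁, p₂, …` factors through the Vandermonde matrix. -/
theorem hankel_psum_eq (R : Type*) [CommRing R] (m : ℕ) :
    (Matrix.of fun a b : Fin m => psum (Fin m) R (a + b + 1)) =
      (Matrix.vandermonde (X : Fin m → MvPolynomial (Fin m) R)).transpose *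
        Matrix.diagonal X * Matrix.vandermonde X := by
  ext1 a b
  simp only [Matrix.of_apply, psum]
  rw [Matrix.mul_apply]
  simp only [Matrix.mul_diagonal, Matrix.transpose_apply, Matrix.vandermonde_apply]
  exact Finset.sum_congr rfl fun i _ => by ring

theorem det_hankel_psum_self_ne_zero (R : Type*) [CommRing R] [IsDomain R] (m : ℕ) :
    (Matrix.of fun a b : Fin m => psum (Fin m) R (a + b + 1)).det ≠ 0 := by
  have hV : (Matrix.vandermonde (X : Fin m → MvPolynomial (Fin m) R)).det ≠ 0 :=
    Matrix.det_vandermonde_ne_zero_iff.mpr (X_injective (σ := Fin m) (R := R))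
  rw [hankel_psum_eq, Matrix.det_mul, Matrix.det_mul, Matrix.det_transpose, Matrix.det_diagonal]
  exact mul_ne_zero (mul_ne_zero hV (Finset.prod_ne_zero_iff.mpr fun i _ => X_ne_zero i)) hV

/-- Setting all but `m` of the variables to zero turns positive power sums into power sums. -/
theorem aeval_psum_restrict (R : Type*) [CommRing R] (m d k : ℕ) (hk : k ≠ 0) :
    aeval (Fin.append (X : Fin m → MvPolynomial (Fin m) R) (fun _ : Fin d => 0))
      (psum (Fin (m + d)) R k) = psum (Fin m) R k := by
  simp [psum, Fin.sum_univ_add, hk]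

theorem det_hankel_psum_ne_zero (R : Type*) [CommRing R] [IsDomain R] {m n : ℕ} (hmn : m ≤ n) :
    (Matrix.of fun a b : Fin m => psum (Fin n) R (a + b + 1)).det ≠ 0 := by
  obtain ⟨d, rfl⟩ := Nat.exists_eq_add_of_le hmn
  intro h
  apply det_hankel_psum_self_ne_zero R m
  have := congrArg
    (aeval (Fin.append (X : Fin m → MvPolynomial (Fin m) R) (fun _ : Fin d => 0))) h
  rw [AlgHom.map_det, map_zero] at this
  rw [← this]
  congr 1
  ext1 a b
  simp only [AlgHom.mapMatrix_apply, Matrix.map_apply, Matrix.of_apply]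
  rw [aeval_psum_restrict _ _ _ _ (Nat.succ_ne_zero _)]

theorem esymm_eq_zero_of_card_lt (R : Type*) [CommRing R] {n k : ℕ} (h : n < k) :
    esymm (Fin n) R k = 0 := by
  rw [esymm, Finset.powersetCard_eq_empty.mpr (by simpa using h), Finset.sum_empty]

/-- Newton's identity in degrees exceeding the number of variables. -/
theorem sum_range_esymm_mul_psum_eq_zero (R : Type*) [CommRing R] {n k : ℕ} (h : n < k) :
    ∑ i ∈ Finset.range (n + 1), (-1) ^ i * esymm (Fin n) R i * psum (Fin n) R (k - i) = 0 := by
  have key := mul_esymm_eq_sum (Fin n) R k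
  rw [esymm_eq_zero_of_card_lt R h, mul_zero, Finset.sum_filter,
    Finset.Nat.sum_antidiagonal_eq_sum_range_succ_mk, Finset.sum_range_succ] at key
  simp only [lt_irrefl, if_false, add_zero] at key
  have hunit : IsUnit ((-1 : MvPolynomial (Fin n) R) ^ (k + 1)) := (isUnit_one.neg).pow _
  have key := (hunit.mul_right_eq_zero).mp key.symm
  rw [← key]
  refine (Finset.sum_congr rfl fun i hi => ?_).trans
    (Finset.sum_subset (Finset.range_mono (Nat.succ_le_of_lt h)) fun i _ hi => ?_)
  · rw [if_pos (by have := Finset.mem_range.mp hi; lia)]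
  · rw [esymm_eq_zero_of_card_lt R (by simpa using hi)]
    simp

section

variable {K L : Type*} [Field K] [Field L] {n : ℕ} [Algebra K L]
  [Algebra (MvPolynomial (Fin n) K) L] (F : IntermediateField K L)

/-- A field containing all `eₖ` contains all power sums of positive degree. -/
theorem psum_mem_of_esymm_mem
    (he : ∀ k ∈ Set.Icc 1 n, algebraMap (MvPolynomial (Fin n) K) L (esymm (Fin n) K k) ∈ F)
    (k : ℕ) (hk : 0 < k) : algebraMap (MvPolynomial (Fin n) K) L (psum (Fin n) K k) ∈ F := by
  have he' : ∀ k, 0 < k → algebraMap (MvPolynomial (Fin n) K) L (esymm (Fin n) K k) ∈ F := by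
    intro k hk
    rcases le_or_gt k n with h | h
    · exact he k ⟨hk, h⟩
    · rw [esymm_eq_zero_of_card_lt K h, map_zero]
      exact F.zero_mem
  induction k using Nat.strong_induction_on with
  | _ k ih =>
    rw [psum_eq_mul_esymm_sub_sum _ _ k hk]
    simp only [map_sub, map_mul, map_pow, map_neg, map_one, map_natCast, map_sum]
    refine F.sub_mem (F.mul_mem (F.mul_mem (pow_mem (F.neg_mem F.one_mem) _)
      (natCast_mem F _)) (he' k hk)) (F.sum_mem fun a ha => ?_)
    simp only [Finset.mem_filter, Finset.HasAntidiagonal.mem_antidiagonal, Set.mem_Ioo] at ha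
    exact F.mul_mem (F.mul_mem (pow_mem (F.neg_mem F.one_mem) _) (he' _ ha.2.1))
      (ih _ (by lia) (by lia))

/-- A field containing `p₁, …, pₖ` contains `eₖ` as long as `1, …, k` are invertible in it. -/
theorem esymm_mem_of_psum_mem {r : ℕ} (hcast : ∀ k, 0 < k → k < r → (k : L) ≠ 0)
    (hp : ∀ k, 0 < k → k < r → algebraMap (MvPolynomial (Fin n) K) L (psum (Fin n) K k) ∈ F)
    (k : ℕ) (hk : k < r) : algebraMap (MvPolynomial (Fin n) K) L (esymm (Fin n) K k) ∈ F := by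
  induction k using Nat.strong_induction_on with
  | _ k ih =>
    rcases Nat.eq_zero_or_pos k with rfl | hpos
    · rw [esymm_zero, map_one]
      exact F.one_mem
    have key := congrArg (algebraMap (MvPolynomial (Fin n) K) L) (mul_esymm_eq_sum (Fin n) K k)
    simp only [map_mul, map_pow, map_neg, map_one, map_natCast, map_sum] at key
    rw [eq_div_of_mul_eq (hcast k hpos hk) ((mul_comm _ _).trans key)]
    refine F.div_mem (F.mul_mem (pow_mem (F.neg_mem F.one_mem) _) (F.sum_mem fun a ha => ?_))
      (natCast_mem F _)
    simp only [Finset.mem_filter, Finset.HasAntidiagonal.mem_antidiagonal] at ha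
    exact F.mul_mem (F.mul_mem (pow_mem (F.neg_mem F.one_mem) _)
      (ih _ ha.2 (by lia))) (hp _ (by lia) (by lia))

/-- If a field contains `e₀, …, eᵣ₋₁` and `p₁, …, p₂ₙ₊₁₋ᵣ`, then it contains `eᵣ, …, eₙ`. -/
theorem esymm_mem_of_esymm_mem_of_psum_mem {r : ℕ} (hr : 0 < r) (hn : r ≤ n)
    (hinj : Function.Injective (algebraMap (MvPolynomial (Fin n) K) L))
    (he : ∀ k < r, algebraMap (MvPolynomial (Fin n) K) L (esymm (Fin n) K k) ∈ F)
    (hp : ∀ k ∈ Set.Icc 1 (2 * n + 1 - r),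
      algebraMap (MvPolynomial (Fin n) K) L (psum (Fin n) K k) ∈ F)
    (k : ℕ) (hrk : r ≤ k) (hk : k ≤ n) :
    algebraMap (MvPolynomial (Fin n) K) L (esymm (Fin n) K k) ∈ F := by
  obtain ⟨m, hm⟩ : ∃ m, n + 1 = r + m := ⟨n + 1 - r, by lia⟩
  let φ := algebraMap (MvPolynomial (Fin n) K) L
  let M : Matrix (Fin m) (Fin m) (MvPolynomial (Fin n) K) :=
    Matrix.of fun a b => psum (Fin n) K (a + b + 1)
  let v : Fin m → L := fun b => (-1) ^ (n - b : ℕ) * φ (esymm (Fin n) K (n - b))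
  have hdet : (φ.mapMatrix M).det ≠ 0 := by
    rw [← RingHom.map_det]
    exact (map_ne_zero_iff φ hinj).mpr (det_hankel_psum_ne_zero K (by lia))
  have hM : ∀ a b, φ.mapMatrix M a b ∈ F := fun a b => hp _ ⟨by lia, by lia⟩
  have hv : ∀ a, (φ.mapMatrix M).mulVec v a ∈ F := by
    intro a
    have key := congrArg φ (sum_range_esymm_mul_psum_eq_zero K (n := n) (k := n + 1 + a) (by lia))
    rw [hm, Finset.sum_range_add, ← Finset.sum_range_reflect _ m] at key
    simp only [map_add, map_sum, map_mul, map_pow, map_neg, map_one, map_zero] at key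
    have hsum : (φ.mapMatrix M).mulVec v a =
        -∑ i ∈ Finset.range r,
          (-1) ^ i * φ (esymm (Fin n) K i) * φ (psum (Fin n) K (r + m + a - i)) := by
      rw [add_eq_zero_iff_neg_eq.mp key, Finset.sum_range, Matrix.mulVec, dotProduct]
      refine Finset.sum_congr rfl fun b _ => ?_
      have h₁ : r + (m - 1 - b) = n - b := by lia
      have h₂ : r + m + a - (n - b) = a + b + 1 := by lia
      rw [h₁, h₂]
      exact mul_comm _ _
    rw [hsum]
    refine F.neg_mem (F.sum_mem fun i hi => ?_)
    have hi := Finset.mem_range.mp hi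
    exact F.mul_mem (F.mul_mem (pow_mem (F.neg_mem F.one_mem) _) (he i hi))
      (hp _ ⟨by lia, by lia⟩)
  have hmem := F.mem_of_mulVec_mem _ v hM hdet hv ⟨n - k, by lia⟩
  have hk' : n - (n - k) = k := by lia
  simp only [v, hk'] at hmem
  have hsq : ((-1 : L) ^ k) * ((-1) ^ k * φ (esymm (Fin n) K k)) = φ (esymm (Fin n) K k) := by
    rw [← mul_assoc, ← mul_pow]
    simp
  exact hsq ▸ F.mul_mem (pow_mem (F.neg_mem F.one_mem) k) hmem

/-- In an extension field `L` of `K[x₁, …, xₙ]`, the subfield generated by `e₁, …, eₙ` is generated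
by `p₁, …, p₂ₙ₊₁₋ᵣ`, where `r` is the characteristic of `K`. -/
theorem adjoin_esymm_eq_adjoin_psum (r : ℕ) (hr : 0 < r) [CharP K r] (hn : r ≤ n)
    (hinj : Function.Injective (algebraMap (MvPolynomial (Fin n) K) L)) :
    IntermediateField.adjoin K
        ((fun k => algebraMap (MvPolynomial (Fin n) K) L (esymm (Fin n) K k)) '' (Set.Icc 1 n)) =
      IntermediateField.adjoin K
        ((fun k => algebraMap (MvPolynomial (Fin n) K) L (psum (Fin n) K k)) ''
          (Set.Icc 1 (2 * n + 1 - r))) := by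
  apply le_antisymm <;> rw [IntermediateField.adjoin_le_iff] <;> rintro _ ⟨k, hk, rfl⟩
  · have hp : ∀ k ∈ Set.Icc 1 (2 * n + 1 - r), _ := fun k hk =>
      IntermediateField.subset_adjoin K _ (Set.mem_image_of_mem
        (fun k => algebraMap (MvPolynomial (Fin n) K) L (psum (Fin n) K k)) hk)
    have he := esymm_mem_of_psum_mem (r := r) _
      (fun k hpos hkr h => by
        rw [← map_natCast (algebraMap K L), map_eq_zero,
          CharP.cast_eq_zero_iff K r] at h
        exact absurd (Nat.le_of_dvd hpos h) (by lia))
      fun k hpos hkr => hp k ⟨hpos, by lia⟩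
    rcases lt_or_ge k r with h | h
    · exact he k h
    · exact esymm_mem_of_esymm_mem_of_psum_mem _ hr hn hinj he hp k h hk.2
  · refine psum_mem_of_esymm_mem _ (fun j hj => ?_) k hk.1
    exact IntermediateField.subset_adjoin K _ ⟨j, hj, rfl⟩

end

end MvPolynomial

/-- For a field `K` of positive characteristic `r` and `n ≥ r` variables, inside the fraction
field of `K[x_1, …, x_n]`, the subfield generated by `K` and `e_1, …, e_n` equals the subfield
generated by `K` and `p_1, …, p_{2n+1-r}`. -/
theorem stmt2 (K : Type*) [Field K] (r : ℕ) (hr : 0 < r) [CharP K r] (n : ℕ) (hn : r ≤ n) :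
    IntermediateField.adjoin K
        ((fun k => algebraMap (MvPolynomial (Fin n) K) (FractionRing (MvPolynomial (Fin n) K))
          (esymm (Fin n) K k)) '' (Set.Icc 1 n)) =
      IntermediateField.adjoin K
        ((fun k => algebraMap (MvPolynomial (Fin n) K) (FractionRing (MvPolynomial (Fin n) K))
          (psum (Fin n) K k)) '' (Set.Icc 1 (2 * n + 1 - r))) :=
  adjoin_esymm_eq_adjoin_psum r hr hn (IsFractionRing.injective _ _)
end

section
/- Let R be a commutative ring and n ≥ 1. Then det P_{n,n} = e_n · ∏_{1 ≤ i < j ≤ n} (x_i − x_j)^2 in R[x_1,…,x_n]. -/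
open MvPolynomial

/-- The Hankel matrix of shifted power sums factors as `Vᵀ * diagonal X * V`, where `V` is the
Vandermonde matrix of the variables. -/
theorem hankel_psum_eq_vandermonde_mul (R : Type*) [CommRing R] (n : ℕ) :
    (Matrix.of fun i j : Fin n => psum (Fin n) R (i.val + j.val + 1)) =
      (Matrix.vandermonde (X : Fin n → MvPolynomial (Fin n) R)).transpose *
        Matrix.diagonal X * Matrix.vandermonde X := by
  ext1 i j
  rw [Matrix.mul_apply]
  simp only [Matrix.of_apply, psum, Matrix.mul_diagonal,
    Matrix.transpose_apply, Matrix.vandermonde_apply]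
  exact Finset.sum_congr rfl fun k _ => by ring

/-- The top elementary symmetric polynomial is the product of the variables. -/
theorem esymm_fin_self (R : Type*) [CommRing R] (n : ℕ) :
    esymm (Fin n) R n = ∏ i, X i := by
  have h : Finset.powersetCard n (Finset.univ : Finset (Fin n)) = {Finset.univ} := by
    simpa using Finset.powersetCard_self (Finset.univ : Finset (Fin n))
  rw [esymm, h, Finset.sum_singleton]

/-- For a commutative ring `R` and `n ≥ 1`, the determinant of the `n × n` Hankel matrix `P_{n,n}`
whose `(i,j)` entry is the power sum `p_{i+j-1}` equals
`e_n · ∏_{1 ≤ i < j ≤ n} (x_i - x_j)^2` in `R[x_1, …, x_n]`. -/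
theorem stmt3 (R : Type*) [CommRing R] (n : ℕ) (hn : 1 ≤ n) :
    Matrix.det (Matrix.of fun i j : Fin n => psum (Fin n) R (i.val + j.val + 1)) =
      esymm (Fin n) R n * ∏ i : Fin n, ∏ j ∈ Finset.Ioi i, (X i - X j) ^ 2 := by
  have hsq : ∏ i : Fin n, ∏ j ∈ Finset.Ioi i, (X i - X j : MvPolynomial (Fin n) R) ^ 2 =
      (∏ i : Fin n, ∏ j ∈ Finset.Ioi i, (X j - X i)) ^ 2 := by
    simp only [← Finset.prod_pow]
    exact Finset.prod_congr rfl fun i _ => Finset.prod_congr rfl fun j _ => by ring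
  rw [hankel_psum_eq_vandermonde_mul, Matrix.det_mul, Matrix.det_mul, Matrix.det_transpose,
    Matrix.det_diagonal, Matrix.det_vandermonde, esymm_fin_self, hsq]
  ring
end

section
/- Let R be a commutative ring and d, n ≥ 1. Then det P_{d,n}(x_1,…,x_n) = Σ_{1 ≤ i_1 < i_2 < … < i_d ≤ n} det P_{d,d}(x_{i_1}, x_{i_2}, …, x_{i_d}); that is, the determinant of the d×d Hankel matrix of power sums in all n variables equals the sum, over all d-element subsets S of {1,…,n}, of the determinant of the d×d Hankel matrix of power sums in the variables indexed by S. -/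
open MvPolynomial

/-- Multilinear expansion, in the columns, of the determinant of a sum of matrices. -/
lemma det_of_sum_eq_sum_piFinset {m ι A : Type*} [Fintype m] [DecidableEq m]
    [CommRing A] (S : Finset ι) (f : ι → m → m → A) :
    Matrix.det (Matrix.of fun i j => ∑ x ∈ S, f x i j) =
      ∑ p ∈ Fintype.piFinset fun _ : m => S, Matrix.det (Matrix.of fun i j => f (p j) i j) := by
  simp only [Matrix.det_apply', Matrix.of_apply, Finset.prod_univ_sum, Finset.mul_sum]
  exact Finset.sum_comm

/-- A matrix built from rank-one pieces has zero determinant when a piece is repeated. -/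
lemma det_of_mul_eq_zero_of_not_injective {m ι A : Type*} [Fintype m] [DecidableEq m]
    [CommRing A] (a b : m → ι → A) {p : m → ι} (hp : ¬ Function.Injective p) :
    Matrix.det (Matrix.of fun i j => a i (p j) * b j (p j)) = 0 := by
  obtain ⟨j, k, hjk, hne⟩ := Function.not_injective_iff.mp hp
  have h := Matrix.det_mul_row (fun j => b j (p j)) (Matrix.of fun i j => a i (p j))
  simp only [Matrix.of_apply, mul_comm (b _ _)] at h
  rw [h, Matrix.det_zero_of_column_eq hne (fun i => by simp [hjk]), mul_zero]

/-- The Gram-type determinant `det (∑ x, a i x * b j x)` over a finite set `T` is the sum of the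
corresponding determinants over the subsets of `T` whose size is that of the matrix. -/
lemma det_of_sum_mul_eq_sum_powersetCard {m ι A : Type*} [Fintype m] [DecidableEq m]
    [DecidableEq ι] [CommRing A] (T : Finset ι) (a b : m → ι → A) :
    Matrix.det (Matrix.of fun i j => ∑ x ∈ T, a i x * b j x) =
      ∑ S ∈ Finset.powersetCard (Fintype.card m) T,
        Matrix.det (Matrix.of fun i j => ∑ x ∈ S, a i x * b j x) := by
  classical
  have expand (S : Finset ι) : Matrix.det (Matrix.of fun i j => ∑ x ∈ S, a i x * b j x) =
      ∑ p ∈ Fintype.piFinset (fun _ : m => S) with Function.Injective p,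
        Matrix.det (Matrix.of fun i j => a i (p j) * b j (p j)) := by
    rw [det_of_sum_eq_sum_piFinset S fun x i j => a i x * b j x, Finset.sum_filter_of_ne]
    exact fun p _ hp => not_imp_comm.mp (det_of_mul_eq_zero_of_not_injective a b) hp
  simp only [expand]
  rw [← Finset.sum_fiberwise_of_maps_to (g := fun p : m → ι => Finset.univ.image p)
    (t := Finset.powersetCard (Fintype.card m) T)]
  · refine Finset.sum_congr rfl fun S hS => Finset.sum_congr ?_ fun _ _ => rfl
    obtain ⟨hST, hcard⟩ := Finset.mem_powersetCard.mp hS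
    ext p
    simp only [Finset.mem_filter, Fintype.mem_piFinset]
    constructor
    · rintro ⟨⟨-, hp⟩, rfl⟩
      exact ⟨fun i => Finset.mem_image_of_mem p (Finset.mem_univ i), hp⟩
    · rintro ⟨hpS, hp⟩
      refine ⟨⟨fun i => hST (hpS i), hp⟩, Finset.eq_of_subset_of_card_le ?_ ?_⟩
      · simpa [Finset.image_subset_iff] using hpS
      · rw [Finset.card_image_of_injective _ hp, hcard, Finset.card_univ]
  · intro p hp
    simp only [Finset.mem_filter, Fintype.mem_piFinset] at hp
    rw [Finset.mem_powersetCard, Finset.card_image_of_injective _ hp.2, Finset.card_univ]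
    exact ⟨by simpa [Finset.image_subset_iff] using hp.1, rfl⟩

/-- For a commutative ring `R` and `d, n ≥ 1`, the determinant of the `d × d` Hankel matrix of
power sums in all `n` variables equals the sum, over all `d`-element subsets `S` of the variables,
of the determinant of the `d × d` Hankel matrix of power sums in the variables of `S`. -/
theorem stmt4 (R : Type*) [CommRing R] (d n : ℕ) (hd : 1 ≤ d) (hn : 1 ≤ n) :
    Matrix.det (Matrix.of fun i j : Fin d => psum (Fin n) R (i.val + j.val + 1)) =
      ∑ S ∈ Finset.powersetCard d (Finset.univ : Finset (Fin n)),
        Matrix.det (Matrix.of fun i j : Fin d =>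
          ∑ x ∈ S, (X x : MvPolynomial (Fin n) R) ^ (i.val + j.val + 1)) := by
  have h := det_of_sum_mul_eq_sum_powersetCard (Finset.univ : Finset (Fin n))
    (fun (i : Fin d) x => (X x : MvPolynomial (Fin n) R) ^ i.val)
    (fun (j : Fin d) x => (X x : MvPolynomial (Fin n) R) ^ (j.val + 1))
  simpa only [← pow_add, ← add_assoc, Fintype.card_fin, psum] using h
end

section
/- Let R be a commutative ring and let 1 ≤ d ≤ n. Then the coefficient of the monomial x_1 · x_2^3 · x_3^5 · ⋯ · x_d^{2d−1} in the polynomial det P_{d,n} ∈ R[x_1,…,x_n] is equal to 1. -/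
open MvPolynomial

/-- If `σ i + i = 2 τ i` for permutations `σ`, `τ` of `Fin d`, then `σ = 1`: comparing sums of
squares gives `∑ (σ i - i) ^ 2 = 0`. -/
lemma Equiv.Perm.eq_one_of_add_eq_two_mul {d : ℕ} (σ τ : Equiv.Perm (Fin d))
    (h : ∀ i, (σ i : ℕ) + i = 2 * (τ i : ℕ)) : σ = 1 := by
  have hσ := Equiv.sum_comp σ (fun i : Fin d => ((i : ℕ) : ℤ) ^ 2)
  have hτ := Equiv.sum_comp τ (fun i : Fin d => ((i : ℕ) : ℤ) ^ 2)
  have hsum : ∑ i, (((σ i : ℕ) : ℤ) - ((i : ℕ) : ℤ)) ^ 2 = 0 := by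
    have hterm : ∀ i, (((σ i : ℕ) : ℤ) - ((i : ℕ) : ℤ)) ^ 2 =
        2 * ((σ i : ℕ) : ℤ) ^ 2 + 2 * ((i : ℕ) : ℤ) ^ 2 - 4 * ((τ i : ℕ) : ℤ) ^ 2 := by
      intro i
      have hi : ((σ i : ℕ) : ℤ) + ((i : ℕ) : ℤ) = 2 * ((τ i : ℕ) : ℤ) := by exact_mod_cast h i
      linear_combination (-((σ i : ℕ) : ℤ) - ((i : ℕ) : ℤ) - 2 * ((τ i : ℕ) : ℤ)) * hi
    simp only [hterm, Finset.sum_sub_distrib, Finset.sum_add_distrib, ← Finset.mul_sum]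
    rw [hσ, hτ]
    ring
  rw [Finset.sum_eq_zero_iff_of_nonneg fun i _ => sq_nonneg _] at hsum
  ext i
  have hi := pow_eq_zero_iff two_ne_zero |>.1 (hsum i (Finset.mem_univ i))
  rw [Equiv.Perm.one_apply]
  omega

/-- The exponent vector of `x_1 · x_2 ^ 3 ⋯ x_d ^ (2 d - 1)` arises in exactly one way from the
expansion of the determinant of power sums. -/
lemma sum_single_eq_odd_exponent_iff {d n : ℕ} (hdn : d ≤ n) (σ : Equiv.Perm (Fin d))
    (f : Fin d → Fin n) :
    ∑ i, Finsupp.single (f i) ((σ i : ℕ) + i + 1) = Finsupp.equivFunOnFinite.symm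
        (fun i : Fin n => if i.val < d then 2 * i.val + 1 else 0) ↔
      σ = 1 ∧ f = Fin.castLE hdn := by
  simp only [DFunLike.ext_iff (F := Fin n →₀ ℕ), Finsupp.finsetSum_apply,
    Finsupp.equivFunOnFinite_symm_apply_apply, Finsupp.single_apply]
  constructor
  · intro h
    have hlt : ∀ i, (f i : ℕ) < d := by
      intro i
      by_contra hi
      have hfi := h (f i)
      rw [if_neg hi, Finset.sum_eq_zero_iff] at hfi
      simpa using hfi i (Finset.mem_univ i)
    have hsurj : Function.Surjective fun i => (⟨f i, hlt i⟩ : Fin d) := by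
      intro j
      by_contra! hj
      have hfj := h (Fin.castLE hdn j)
      rw [Finset.sum_eq_zero] at hfj
      · simp at hfj
      · intro i _
        refine if_neg fun hij => hj i ?_
        ext
        simp [hij]
    have hbij := Finite.injective_iff_bijective.1 (Finite.injective_iff_surjective.2 hsurj)
    have hadd : ∀ i, (σ i : ℕ) + i = 2 * (f i : ℕ) := by
      intro i
      have hfi := h (f i)
      rw [if_pos (hlt i), Finset.sum_eq_single i, if_pos rfl] at hfi
      · omega
      · intro j _ hji
        refine if_neg fun hf => hji (hbij.1 ?_)
        ext
        simp [hf]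
      · simp
    have hσ : σ = 1 := σ.eq_one_of_add_eq_two_mul (Equiv.ofBijective _ hbij) hadd
    refine ⟨hσ, ?_⟩
    ext i
    have hi := hadd i
    rw [hσ, Equiv.Perm.one_apply] at hi
    rw [Fin.val_castLE]
    omega
  · rintro ⟨rfl, rfl⟩ j
    split_ifs with hj
    · rw [Finset.sum_eq_single ⟨j, hj⟩]
      · rw [if_pos (by ext; rfl), Equiv.Perm.one_apply]
        ring
      · intro i _ hi
        refine if_neg fun hij => hi ?_
        ext
        simp [← hij]
      · simp
    · refine Finset.sum_eq_zero fun i _ => if_neg ?_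
      rintro rfl
      exact hj i.2

/-- A product of power sums expands as a sum of monomials over all choices of variables. -/
lemma prod_psum_eq_sum_monomial {ι σ R : Type*} [Fintype ι] [DecidableEq ι] [Fintype σ]
    [CommRing R] (k : ι → ℕ) :
    ∏ i, psum σ R (k i) =
      ∑ f : ι → σ, monomial (∑ i, Finsupp.single (f i) (k i)) (1 : R) := by
  simp only [psum, Finset.prod_univ_sum, Fintype.piFinset_univ, monomial_sum_one,
    X_pow_eq_monomial]

/-- For a commutative ring `R` and `1 ≤ d ≤ n`, the coefficient of the monomial
`x_1 · x_2^3 · x_3^5 ⋯ x_d^{2d-1}` in `det P_{d,n}` is `1`. -/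
theorem stmt5 (R : Type*) [CommRing R] (d n : ℕ) (hd : 1 ≤ d) (hdn : d ≤ n) :
    MvPolynomial.coeff
        (Finsupp.equivFunOnFinite.symm (fun i : Fin n => if i.val < d then 2 * i.val + 1 else 0))
        (Matrix.det (Matrix.of fun i j : Fin d => psum (Fin n) R (i.val + j.val + 1))) = 1 := by
  simp only [Matrix.det_apply, Matrix.of_apply, prod_psum_eq_sum_monomial, coeff_sum,
    Units.smul_def, coeff_smul, coeff_monomial, sum_single_eq_odd_exponent_iff hdn]
  rw [Finset.sum_eq_single 1]
  · simp
  · intro σ _ hσ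
    simp [hσ]
  · simp
end

section
/- Let R be a nontrivial commutative ring and let d, n ≥ 1. Then det P_{d,n} ≠ 0 in R[x_1,…,x_n] if and only if d ≤ n. -/
open MvPolynomial

/-- The Hankel matrix of power sums of `v` factors as `Vᵀ * diagonal v * V` with `V` the
Vandermonde matrix of `v`. -/
theorem det_hankel_sum_pow {S : Type*} [CommRing S] {d : ℕ} (v : Fin d → S) :
    (Matrix.of fun i j : Fin d => ∑ k, v k ^ (i.val + j.val + 1)).det =
      (Matrix.vandermonde v).det ^ 2 * ∏ k, v k := by
  have h : (Matrix.of fun i j : Fin d => ∑ k, v k ^ (i.val + j.val + 1)) =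
      (Matrix.vandermonde v).transpose * Matrix.diagonal v * Matrix.vandermonde v := by
    ext i j
    rw [Matrix.mul_apply]
    simp only [Matrix.of_apply, Matrix.mul_diagonal, Matrix.transpose_apply,
      Matrix.vandermonde_apply]
    exact Finset.sum_congr rfl fun k _ => by ring
  rw [h, Matrix.det_mul, Matrix.det_mul, Matrix.det_transpose, Matrix.det_diagonal]
  ring

/-- Padding by zeros does not change the power sums of positive degree. -/
theorem sum_append_zero_pow_succ {S : Type*} [CommRing S] {n m : ℕ} (v : Fin n → S) (k : ℕ) :
    ∑ i, Fin.append v (0 : Fin m → S) i ^ (k + 1) = ∑ i, v i ^ (k + 1) := by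
  simp [Fin.sum_univ_add]

theorem det_hankel_sum_pow_eq_zero {S : Type*} [CommRing S] {d n : ℕ} (h : n < d)
    (v : Fin n → S) :
    (Matrix.of fun i j : Fin d => ∑ k, v k ^ (i.val + j.val + 1)).det = 0 := by
  obtain ⟨m, rfl⟩ := Nat.exists_eq_add_of_lt h
  have hdet := det_hankel_sum_pow (Fin.append v (0 : Fin (m + 1) → S))
  simp only [sum_append_zero_pow_succ] at hdet
  refine hdet.trans ?_
  simp [Fin.prod_univ_add]

theorem det_hankel_sum_X_pow_ne_zero (K : Type*) [Field K] (d : ℕ) :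
    (Matrix.of fun i j : Fin d =>
      ∑ k, (X k : MvPolynomial (Fin d) K) ^ (i.val + j.val + 1)).det ≠ 0 := by
  rw [det_hankel_sum_pow]
  exact mul_ne_zero (pow_ne_zero _ (Matrix.det_vandermonde_ne_zero_iff.mpr X_injective))
    (Finset.prod_ne_zero_iff.mpr fun k _ => X_ne_zero k)

/-- For a nontrivial commutative ring `R` and `d, n ≥ 1`, the determinant of the Hankel matrix
`P_{d,n}` of power sums is nonzero in `R[x_1, …, x_n]` if and only if `d ≤ n`. -/
theorem stmt6 (R : Type*) [CommRing R] [Nontrivial R] (d n : ℕ) (hd : 1 ≤ d) (hn : 1 ≤ n) :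
    Matrix.det (Matrix.of fun i j : Fin d => psum (Fin n) R (i.val + j.val + 1)) ≠ 0 ↔ d ≤ n := by
  constructor
  · intro h
    by_contra! hlt
    exact h (det_hankel_sum_pow_eq_zero hlt X)
  · intro h h0
    obtain ⟨m, rfl⟩ := Nat.exists_eq_add_of_le h
    obtain ⟨I, hI⟩ := Ideal.exists_maximal R
    let := Ideal.Quotient.field I
    let φ : MvPolynomial (Fin (d + m)) R →+* MvPolynomial (Fin d) (R ⧸ I) :=
      eval₂Hom (C.comp (Ideal.Quotient.mk I)) (Fin.append X 0)
    apply det_hankel_sum_X_pow_ne_zero (R ⧸ I) d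
    have hφ := congrArg φ h0
    rw [RingHom.map_det, map_zero] at hφ
    rw [← hφ]
    congr 1
    ext1 i j
    simp only [Matrix.of_apply, RingHom.mapMatrix_apply, Matrix.map_apply, psum, map_sum, map_pow,
      φ, eval₂Hom_X', sum_append_zero_pow_succ]
end

section
/- Let R be a commutative ring and d ≥ 1, and work in d variables x_1,…,x_d. Then det P_{d,d} = Σ_{σ ∈ S_d} det A_σ, where S_d is the symmetric group on d letters and A_σ is the d×d matrix whose (i,j) entry, for 1 ≤ i,j ≤ d, is x_{σ(i)}^{i+j−1}. -/
open MvPolynomial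

/-- The determinant of a product `V * A`, expanded along the summation indices chosen in each
row: only the bijective choices contribute. -/
theorem Matrix.det_mul_eq_sum_perm_det {n S : Type*} [Fintype n] [DecidableEq n] [CommRing S]
    (V A : Matrix n n S) :
    (V * A).det =
      ∑ σ : Equiv.Perm n, (Matrix.of fun i j => V i (σ i) * A (σ i) j).det := by
  have expand (σ : Equiv.Perm n) : (Matrix.of fun i j => V i (σ i) * A (σ i) j).det =
      (Equiv.Perm.sign σ : S) * (∏ i, V i (σ i)) * A.det := by
    have h := Matrix.det_mul_column (fun i => V i (σ i)) (A.submatrix σ id)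
    simp only [Matrix.submatrix_apply, id] at h
    rw [h, Matrix.det_permute]
    ring
  simp_rw [expand]
  rw [← Finset.sum_mul, Matrix.det_mul, ← Matrix.det_transpose V, Matrix.det_apply']
  simp only [Matrix.transpose_apply]

/-- For a commutative ring `R` and `d ≥ 1`, working in `d` variables, the determinant of the
Hankel matrix `P_{d,d}` of power sums equals the sum over all permutations `σ ∈ S_d` of the
determinant of the matrix whose `(i,j)` entry is `x_{σ(i)}^{i+j-1}`. -/
theorem stmt7 (R : Type*) [CommRing R] (d : ℕ) (hd : 1 ≤ d) :
    Matrix.det (Matrix.of fun i j : Fin d => psum (Fin d) R (i.val + j.val + 1)) =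
      ∑ σ : Equiv.Perm (Fin d),
        Matrix.det (Matrix.of fun i j : Fin d =>
          (X (σ i) : MvPolynomial (Fin d) R) ^ (i.val + j.val + 1)) := by
  have split (k i j : Fin d) : (X k : MvPolynomial (Fin d) R) ^ (i.val + j.val + 1) =
      X k ^ i.val * X k ^ (j.val + 1) := by
    rw [← pow_add, add_assoc]
  simp_rw [psum, split]
  exact Matrix.det_mul_eq_sum_perm_det
    (Matrix.of fun i k : Fin d => (X k : MvPolynomial (Fin d) R) ^ i.val)
    (Matrix.of fun k j : Fin d => (X k : MvPolynomial (Fin d) R) ^ (j.val + 1))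
end

section
/- Let R be a commutative ring and let f ∈ R[x_1,…,x_n] be a zero divisor in the multivariate polynomial ring. Then there exists a nonzero element r ∈ R such that r · f = 0 (equivalently, r annihilates every coefficient of f). -/
open MvPolynomial

/-- **McCoy's theorem**: a multivariate polynomial killed by a nonzero polynomial is killed by a
nonzero constant. The constant is the leading coefficient of a nonzero annihilator of minimal
degree for a given monomial order. -/
theorem MonomialOrder.exists_C_mul_eq_zero {σ R : Type*} [CommRing R] (m : MonomialOrder σ)
    {f : MvPolynomial σ R} (hf : ∃ g : MvPolynomial σ R, g ≠ 0 ∧ f * g = 0) :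
    ∃ r : R, r ≠ 0 ∧ C r * f = 0 := by
  classical
  obtain ⟨g, ⟨hg, hfg⟩, hmin⟩ :=
    (InvImage.wf (fun g : MvPolynomial σ R => m.toSyn (m.degree g)) wellFounded_lt).has_min
      {g | g ≠ 0 ∧ f * g = 0} hf
  have hcoeff : ∀ d, C (f.coeff d) * g = 0 := by
    by_contra! hne
    have hfin : {d | C (f.coeff d) * g ≠ 0}.Finite := by
      refine f.support.finite_toSet.subset fun d hd => ?_
      rw [Finset.mem_coe, mem_support_iff]
      intro h
      exact hd (by simp [h])
    obtain ⟨d, hd, hmax⟩ := hfin.exists_maximalFor m.toSyn _ hne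
    have hlead : f.coeff d * m.leadingCoeff g = 0 := by
      have h := congrArg (coeff (d + m.degree g)) hfg
      rw [coeff_mul, coeff_zero, Finset.sum_eq_single (d, m.degree g)] at h
      · exact h
      · rintro ⟨i, j⟩ hij hne'
        rw [Finset.HasAntidiagonal.mem_antidiagonal] at hij
        rcases lt_trichotomy (m.toSyn i) (m.toSyn d) with hlt | heq | hgt
        · have hj : m.toSyn (m.degree g) < m.toSyn j := by
            have hsum := congrArg m.toSyn hij
            simp only [map_add] at hsum
            by_contra! hle
            exact (add_lt_add_of_lt_of_le hlt hle).ne hsum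
          simp [m.coeff_eq_zero_of_lt hj]
        · obtain rfl := m.toSyn.injective heq
          exact absurd (by simpa using hij) hne'
        · have hi : C (f.coeff i) * g = 0 := by
            by_contra hi
            exact (hmax hi hgt.le).not_gt hgt
          simpa using congrArg (coeff j) hi
      · simp
    refine hmin (C (f.coeff d) * g) ⟨hd, by rw [mul_left_comm, hfg, mul_zero]⟩ ?_
    have hle : m.toSyn (m.degree (C (f.coeff d) * g)) ≤ m.toSyn (m.degree g) := by
      simpa using m.degree_mul_le (f := C (f.coeff d)) (g := g)
    refine lt_of_le_of_ne hle fun heq => ?_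
    refine m.leadingCoeff_ne_zero_iff.mpr hd ?_
    rw [MonomialOrder.leadingCoeff, m.toSyn.injective heq, coeff_C_mul]
    exact hlead
  refine ⟨m.leadingCoeff g, m.leadingCoeff_ne_zero_iff.mpr hg, ?_⟩
  ext d
  have h := congrArg (coeff (m.degree g)) (hcoeff d)
  rw [coeff_C_mul, coeff_zero] at h
  rw [coeff_C_mul, coeff_zero, mul_comm]
  exact h

/-- If `f ∈ R[x_1, …, x_n]` is a zero divisor, then there is a nonzero `r ∈ R` annihilating `f`
(hence every coefficient of `f`). -/
theorem stmt8 (R : Type*) [CommRing R] (n : ℕ) (f : MvPolynomial (Fin n) R)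
    (hf : ∃ g : MvPolynomial (Fin n) R, g ≠ 0 ∧ f * g = 0) :
    ∃ r : R, r ≠ 0 ∧ C r * f = 0 :=
  MonomialOrder.lex.exists_C_mul_eq_zero hf
end

section
/- Let R be a nontrivial commutative ring and let 1 ≤ d ≤ n. Then det P_{d,n} is not a zero divisor in R[x_1,…,x_n]. -/
open MvPolynomial

/-- A polynomial whose constant coefficient is not a zero divisor is not a zero divisor. -/
theorem MvPolynomial.mem_nonZeroDivisors_of_constantCoeff {σ R : Type*} [CommRing R]
    {f : MvPolynomial σ R} (hf : constantCoeff f ∈ nonZeroDivisors R) :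
    f ∈ nonZeroDivisors (MvPolynomial σ R) := by
  refine mem_nonZeroDivisors_of_injective (f := coeToMvPowerSeries.ringHom (σ := σ) (R := R))
    (coe_injective σ R) (MvPowerSeries.mem_nonZeroDivisors_of_constantCoeff ?_)
  simpa [constantCoeff_eq, ← MvPowerSeries.coeff_zero_eq_constantCoeff_apply] using hf

/-- The difference of two distinct variables is not a zero divisor. -/
theorem MvPolynomial.X_sub_X_mem_nonZeroDivisors {σ R : Type*} [LinearOrder σ] [WellFoundedGT σ]
    [CommRing R] {i j : σ} (hij : i < j) :
    (X j - X i : MvPolynomial σ R) ∈ nonZeroDivisors (MvPolynomial σ R) := by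
  nontriviality R
  apply MonomialOrder.lex.mem_nonZeroDivisors_of_leadingCoeff_mem_nonZeroDivisors
  have hlt : MonomialOrder.lex.toSyn (MonomialOrder.lex.degree (X j : MvPolynomial σ R)) <
      MonomialOrder.lex.toSyn (MonomialOrder.lex.degree (X i : MvPolynomial σ R)) := by
    rw [MonomialOrder.degree_X, MonomialOrder.degree_X, MonomialOrder.lex_lt_iff]
    exact Finsupp.Lex.single_lt_iff.mpr hij
  rw [← neg_sub, MonomialOrder.leadingCoeff_neg, MonomialOrder.leadingCoeff_sub_of_lt hlt,
    MonomialOrder.leadingCoeff_X]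
  exact isUnit_one.neg.mem_nonZeroDivisors

/-- When the Hankel matrix of power sums has as many rows as there are variables, its determinant
is the product of the variables times the square of the Vandermonde determinant. -/
theorem MvPolynomial.det_hankel_psum (R : Type*) [CommRing R] (d : ℕ) :
    Matrix.det (Matrix.of fun i j : Fin d => psum (Fin d) R (i.val + j.val + 1)) =
      (∏ i, X i) * (Matrix.vandermonde (X : Fin d → MvPolynomial (Fin d) R)).det ^ 2 := by
  have h : (Matrix.of fun i j : Fin d => psum (Fin d) R (i.val + j.val + 1)) =
      (Matrix.vandermonde X).transpose * (Matrix.diagonal X * Matrix.vandermonde X) := by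
    ext1 i j
    rw [Matrix.mul_apply]
    simp only [Matrix.of_apply, psum, Matrix.diagonal_mul, Matrix.transpose_apply,
      Matrix.vandermonde_apply]
    exact Finset.sum_congr rfl fun k _ => by ring
  rw [h, Matrix.det_mul, Matrix.det_mul, Matrix.det_transpose, Matrix.det_diagonal]
  ring

theorem MvPolynomial.det_hankel_psum_mem_nonZeroDivisors (R : Type*) [CommRing R] (d : ℕ) :
    Matrix.det (Matrix.of fun i j : Fin d => psum (Fin d) R (i.val + j.val + 1)) ∈
      nonZeroDivisors (MvPolynomial (Fin d) R) := by
  rw [det_hankel_psum, Matrix.det_vandermonde]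
  refine mul_mem (prod_mem fun i _ => ?_) (pow_mem (prod_mem fun i _ => prod_mem fun j hj => ?_) 2)
  · exact (isRegular_X (R := R) (n := i)).mem_nonZeroDivisors
  · exact X_sub_X_mem_nonZeroDivisors (Finset.mem_Ioi.mp hj)

/-- Setting a block of variables to zero sends positive power sums to power sums in the
remaining variables. -/
theorem MvPolynomial.constantCoeff_sumAlgEquiv_rename_psum (R : Type*) [CommRing R]
    {σ τ υ : Type*} [Fintype σ] [Fintype τ] [Fintype υ] (e : υ ≃ σ ⊕ τ) (k : ℕ) :
    constantCoeff (sumAlgEquiv R σ τ (rename e (psum υ R (k + 1)))) = psum τ R (k + 1) := by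
  have h : rename e (psum υ R (k + 1)) = psum (σ ⊕ τ) R (k + 1) := rename_psum _ R _ e
  rw [h]
  simp [psum, Fintype.sum_sum_type]

/-- For a nontrivial commutative ring `R` and `1 ≤ d ≤ n`, the determinant of the Hankel matrix
`P_{d,n}` of power sums is not a zero divisor in `R[x_1, …, x_n]`. -/
theorem stmt9 (R : Type*) [CommRing R] [Nontrivial R] (d n : ℕ) (hd : 1 ≤ d) (hdn : d ≤ n) :
    ¬ ∃ g : MvPolynomial (Fin n) R, g ≠ 0 ∧
        Matrix.det (Matrix.of fun i j : Fin d => psum (Fin n) R (i.val + j.val + 1)) * g = 0 := by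
  obtain ⟨m, rfl⟩ := Nat.exists_eq_add_of_le' hdn
  let e : Fin (m + d) ≃ Fin m ⊕ Fin d := finSumFinEquiv.symm
  let φ : MvPolynomial (Fin (m + d)) R →+* MvPolynomial (Fin m) (MvPolynomial (Fin d) R) :=
    (sumAlgEquiv R (Fin m) (Fin d) : _ →+* _).comp (rename e : _ →ₐ[R] _).toRingHom
  have hφ : Function.Injective φ :=
    (sumAlgEquiv R (Fin m) (Fin d)).injective.comp (rename_injective e e.injective)
  have hdet : Matrix.det (Matrix.of fun i j : Fin d =>
      psum (Fin (m + d)) R (i.val + j.val + 1)) ∈ nonZeroDivisors _ := by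
    refine mem_nonZeroDivisors_of_injective hφ (mem_nonZeroDivisors_of_constantCoeff ?_)
    rw [RingHom.map_det, RingHom.map_det]
    convert det_hankel_psum_mem_nonZeroDivisors R d using 2
    ext1 i j
    exact constantCoeff_sumAlgEquiv_rename_psum R e _
  rintro ⟨g, hg, h⟩
  exact hg ((mul_left_mem_nonZeroDivisors_eq_zero_iff hdet).mp h)
end

section
/- Let K be a field of positive characteristic r and let the number of variables satisfy n ≥ r. Then the K-subalgebra of K[x_1,…,x_n] generated by the power sum polynomials p_1, p_2, …, p_{2n+1−r} has transcendence degree n over K. -/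
open MvPolynomial

/-- A generalized Vandermonde determinant with distinct exponents is nonzero over any
nontrivial commutative ring. -/
theorem MvPolynomial.det_X_pow_ne_zero {ι R : Type*} [Fintype ι] [DecidableEq ι] [CommRing R]
    [Nontrivial R] {a : ι → ℕ} (ha : Function.Injective a) :
    (Matrix.of fun j i : ι => (X i ^ a j : MvPolynomial ι R)).det ≠ 0 := by
  classical
  intro h
  have hprod : ∀ σ : Equiv.Perm ι, ∏ i, (X i ^ a (σ i) : MvPolynomial ι R) =
      monomial (Finsupp.equivFunOnFinite.symm (a ∘ σ)) 1 := by
    intro σ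
    rw [monomial_eq, C_1, one_mul, Finsupp.prod_fintype _ _ (fun _ => pow_zero _)]
    rfl
  have hcoeff := congrArg (coeff (Finsupp.equivFunOnFinite.symm a)) h
  simp only [Matrix.det_apply, Matrix.of_apply, hprod, coeff_sum, coeff_zero] at hcoeff
  rw [Finset.sum_eq_single 1] at hcoeff
  · simp at hcoeff
  · intro σ _ hσ
    rw [Units.smul_def, coeff_smul, coeff_monomial, if_neg, smul_zero]
    intro hσa
    exact hσ (Equiv.ext fun i => ha (congrFun (Finsupp.equivFunOnFinite.symm.injective hσa) i))
  · simp

/-- A homogeneous square linear system with nonzero determinant, with unknowns in a vector space,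
has only the zero solution. -/
theorem Matrix.eq_zero_of_forall_sum_smul_eq_zero {ι F M : Type*} [Fintype ι] [DecidableEq ι]
    [Field F] [AddCommGroup M] [Module F M] {B : Matrix ι ι F} (hB : B.det ≠ 0) {v : ι → M}
    (h : ∀ j, ∑ i, B j i • v i = 0) (i : ι) : v i = 0 := by
  rw [← Module.forall_dual_apply_eq_zero_iff F]
  intro φ
  refine congrFun (Matrix.eq_zero_of_mulVec_eq_zero hB (v := φ ∘ v) (funext fun j => ?_)) i
  simpa [Matrix.mulVec, dotProduct] using congrArg φ (h j)

/-- If the universal `L`-derivation of the field of rational functions kills the variables, then the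
module of Kähler differentials over `L` vanishes. -/
theorem KaehlerDifferential.subsingleton_of_D_X_eq_zero {ι K L F : Type*} [Field K] [Field L]
    [Field F] [Algebra K L] [Algebra K F] [Algebra L F] [IsScalarTower K L F]
    [Algebra (MvPolynomial ι K) F] [IsScalarTower K (MvPolynomial ι K) F]
    [IsFractionRing (MvPolynomial ι K) F]
    (h : ∀ i, D L F (algebraMap (MvPolynomial ι K) F (X i)) = 0) :
    Subsingleton (KaehlerDifferential L F) := by
  have hpoly : ∀ q : MvPolynomial ι K, D L F (algebraMap _ F q) = 0 := by
    intro q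
    induction q using MvPolynomial.induction_on with
    | C c =>
      rw [← algebraMap_eq, ← IsScalarTower.algebraMap_apply, IsScalarTower.algebraMap_apply K L F,
        Derivation.map_algebraMap]
    | add p q hp hq => rw [map_add, map_add, hp, hq, add_zero]
    | mul_X p i hp => rw [map_mul, Derivation.leibniz, hp, h, smul_zero, smul_zero, add_zero]
  have hD : ∀ x : F, D L F x = 0 := by
    intro x
    obtain ⟨p, q, -, rfl⟩ := IsFractionRing.div_surjective (A := MvPolynomial ι K) x
    rw [Derivation.leibniz_div, hpoly, hpoly]
    simp
  rw [← Submodule.subsingleton_iff F, ← subsingleton_iff_bot_eq_top, ← span_range_derivation,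
    eq_comm, Submodule.span_eq_bot]
  rintro _ ⟨x, rfl⟩
  exact hD x

/-- Power sums of pairwise distinct degrees, all nonzero in the field `K`, are algebraically
independent when there are as many of them as variables. -/
theorem MvPolynomial.algebraicIndependent_psum {ι K : Type*} [Fintype ι] [Field K]
    {k : ι → ℕ} (hk : Function.Injective k) (hk0 : ∀ j, (k j : K) ≠ 0) :
    AlgebraicIndependent K fun j => psum ι K (k j) := by
  classical
  let A := MvPolynomial ι K
  let F := FractionRing A
  let y : ι → F := fun j => algebraMap A F (psum ι K (k j))
  let L := IntermediateField.adjoin K (Set.range y)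
  have hpos : ∀ j, k j ≠ 0 := fun j hj => hk0 j (by rw [hj, Nat.cast_zero])
  have hdet : (Matrix.of fun j i : ι => algebraMap A F (X i ^ (k j - 1))).det ≠ 0 := by
    have hinj : Function.Injective fun j => k j - 1 := fun i j hij => by
      have := hpos i
      have := hpos j
      exact hk (by simp only at hij; omega)
    have := det_X_pow_ne_zero (R := K) hinj
    rw [← map_ne_zero_iff (algebraMap A F) (IsFractionRing.injective A F), RingHom.map_det] at this
    exact this
  have hX : ∀ i, KaehlerDifferential.D L F (algebraMap A F (X i)) = 0 := by
    intro i
    refine Matrix.eq_zero_of_forall_sum_smul_eq_zero hdet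
      (v := fun i => KaehlerDifferential.D L F (algebraMap A F (X i))) (fun j => ?_) i
    have hy : KaehlerDifferential.D L F (y j) = 0 :=
      (KaehlerDifferential.D L F).map_algebraMap
        ⟨y j, IntermediateField.subset_adjoin K _ ⟨j, rfl⟩⟩
    have hkF : (k j : F) ≠ 0 := by
      have := (map_ne_zero (algebraMap K F)).2 (hk0 j)
      rwa [map_natCast] at this
    simp only [y, psum, map_sum, map_pow, Derivation.leibniz_pow, ← Finset.smul_sum] at hy
    rw [← Nat.cast_smul_eq_nsmul F, smul_eq_zero, or_iff_right hkF] at hy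
    simpa using hy
  have hsub : Subsingleton (KaehlerDifferential L F) :=
    KaehlerDifferential.subsingleton_of_D_X_eq_zero hX
  have hunr : Algebra.FormallyUnramified L F := ⟨hsub⟩
  have hK : Algebra.EssFiniteType K F := Algebra.EssFiniteType.comp K A F
  have hL : Algebra.EssFiniteType L F := Algebra.EssFiniteType.of_comp K L F
  have hsep : Algebra.IsSeparable L F := Algebra.FormallyUnramified.isSeparable L F
  have halg : Algebra.IsAlgebraic (Algebra.adjoin K (Set.range y)) F :=
    IntermediateField.isAlgebraic_adjoin_iff_top.1 hsep.isAlgebraic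
  have hAF : Algebra.IsAlgebraic A F :=
    (IsFractionRing.comap_isAlgebraic_iff (K := F)).2 inferInstance
  have hF : IsTranscendenceBasis K (algebraMap A F ∘ X) :=
    (IsTranscendenceBasis.mvPolynomial ι K).algebraMap_comp
  have hy : IsTranscendenceBasis K y :=
    Algebra.IsAlgebraic.isTranscendenceBasis_of_lift_le_trdeg_of_finite K y
      hF.lift_cardinalMk_eq_trdeg.le
  exact AlgebraicIndependent.of_comp (IsScalarTower.toAlgHom K A F) hy.1

/-- Among `1, …, 2n + 1 - r` there are at least `n` numbers not divisible by `r`. -/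
theorem Nat.le_card_filter_not_dvd {r n : ℕ} (hr : 2 ≤ r) (hn : r ≤ n) :
    n ≤ ((Finset.Ioc 0 (2 * n + 1 - r)).filter fun k => ¬ r ∣ k).card := by
  have hcard := Finset.card_filter_add_card_filter_not (s := Finset.Ioc 0 (2 * n + 1 - r)) (r ∣ ·)
  rw [Nat.Ioc_filter_dvd_card_eq_div, Nat.card_Ioc] at hcard
  have hdiv : (2 * n + 1 - r) / r ≤ n + 1 - r := by
    obtain ⟨m, rfl⟩ := Nat.exists_eq_add_of_le hn
    rw [← Nat.lt_succ_iff, Nat.div_lt_iff_lt_mul (by omega)]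
    have : r + m + 1 - r = m + 1 := by omega
    rw [this]
    have : m * 2 ≤ m * r := Nat.mul_le_mul_left m hr
    rw [Nat.succ_eq_add_one, add_mul, add_mul]
    omega
  omega



/-- For a field `K` of positive characteristic `r` and `n ≥ r` variables, the `K`-subalgebra of
`K[x_1, …, x_n]` generated by the power sums `p_1, …, p_{2n+1-r}` has transcendence degree `n`
over `K`: there is a maximal algebraically independent subset of it of cardinality `n`. -/
theorem stmt10 (K : Type*) [Field K] (r : ℕ) (hr : 0 < r) [CharP K r] (n : ℕ) (hn : r ≤ n) :
    ∃ s : Set (MvPolynomial (Fin n) K),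
      s ⊆ (Algebra.adjoin K
          ((fun k => psum (Fin n) K k) '' (Set.Icc 1 (2 * n + 1 - r))) : Set (MvPolynomial (Fin n) K)) ∧
      AlgebraicIndependent K ((↑) : s → MvPolynomial (Fin n) K) ∧
      (∀ t : Set (MvPolynomial (Fin n) K), s ⊆ t →
        t ⊆ (Algebra.adjoin K
          ((fun k => psum (Fin n) K k) '' (Set.Icc 1 (2 * n + 1 - r))) : Set (MvPolynomial (Fin n) K)) →
        AlgebraicIndependent K ((↑) : t → MvPolynomial (Fin n) K) → t = s) ∧
      Cardinal.mk s = n := by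
  have hp : r.Prime := (CharP.char_is_prime_or_zero K r).resolve_right hr.ne'
  obtain ⟨e⟩ : Nonempty (Fin n ↪ (Finset.Ioc 0 (2 * n + 1 - r)).filter fun k => ¬ r ∣ k) :=
    Function.Embedding.nonempty_of_card_le (by
      simpa using Nat.le_card_filter_not_dvd hp.two_le hn)
  have he : ∀ j, (e j : ℕ) ∈ Set.Icc 1 (2 * n + 1 - r) ∧ ¬ r ∣ (e j : ℕ) := fun j => by
    have := (e j).2
    rwa [Finset.mem_filter, Finset.mem_Ioc] at this
  have hind : AlgebraicIndependent K fun j => psum (Fin n) K (e j) :=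
    algebraicIndependent_psum (Subtype.val_injective.comp e.injective) fun j => by
      rw [Ne, CharP.cast_eq_zero_iff K r]
      exact (he j).2
  have hbasis := hind.isTranscendenceBasis_of_lift_trdeg_le_of_finite (by simp)
  refine ⟨Set.range fun j => psum (Fin n) K (e j), ?_, hind.to_subtype_range, ?_, ?_⟩
  · rintro _ ⟨j, rfl⟩
    exact Algebra.subset_adjoin ⟨_, (he j).1, rfl⟩
  · intro t hst _ ht
    exact (hbasis.2 t ht hst).symm
  · simpa using Cardinal.mk_range_eq_of_injective hind.injective
end

section
/- Let K be a field of positive characteristic r and n ≥ 1. Let E be the K-subalgebra of K[x_1,…,x_n] generated by all products e_λ = e_{k_1}·e_{k_2}·⋯·e_{k_l}, where λ = (k_1,…,k_l) ranges over integer partitions (finite multisets of positive integers) having at least one part k_i not divisible by r. Then the K-subalgebra generated by all power sum polynomials p_k, k ≥ 1, is contained in E. -/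
open MvPolynomial

/-- The products `e_μ` over multisets `μ` of positive integers with a part not divisible by `r`. -/
def esymmProducts (σ K : Type*) [Fintype σ] [CommRing K] (r : ℕ) : Set (MvPolynomial σ K) :=
  {f | ∃ μ : Multiset ℕ, (∀ k ∈ μ, 0 < k) ∧ (∃ k ∈ μ, ¬ r ∣ k) ∧
    f = (μ.map (esymm σ K)).prod}

theorem esymm_mul_mem_span_esymmProducts {σ K : Type*} [Fintype σ] [CommRing K] {r j : ℕ}
    (hj : 0 < j) {f : MvPolynomial σ K} (hf : f ∈ Submodule.span K (esymmProducts σ K r)) :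
    esymm σ K j * f ∈ Submodule.span K (esymmProducts σ K r) := by
  induction hf using Submodule.span_induction with
  | mem f hf =>
    obtain ⟨μ, hpos, ⟨k, hk, hrk⟩, rfl⟩ := hf
    exact Submodule.subset_span ⟨j ::ₘ μ, by simpa [hj] using hpos,
      ⟨k, Multiset.mem_cons_of_mem hk, hrk⟩, by simp⟩
  | zero => simp
  | add f g _ _ hf hg => simpa [mul_add] using add_mem hf hg
  | smul c f _ hf => simpa using Submodule.smul_mem _ c hf

theorem natCast_mul_esymm_mem_span_esymmProducts (σ K : Type*) [Fintype σ] [CommRing K] (r : ℕ)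
    [CharP K r] {k : ℕ} (hk : 0 < k) :
    (k : MvPolynomial σ K) * esymm σ K k ∈ Submodule.span K (esymmProducts σ K r) := by
  by_cases hrk : r ∣ k
  · simp [(CharP.cast_eq_zero_iff (MvPolynomial σ K) r k).2 hrk]
  · rw [← nsmul_eq_mul]
    refine nsmul_mem (Submodule.subset_span ?_) k
    exact ⟨{k}, by simpa using hk, by simpa using hrk, by simp⟩

theorem neg_one_pow_mul_mem {A : Type*} [Ring A] {R : Type*} [Ring R] [Module R A]
    (S : Submodule R A) (m : ℕ) {f : A} (hf : f ∈ S) : (-1) ^ m * f ∈ S := by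
  rcases neg_one_pow_eq_or A m with h | h <;> simpa [h] using hf

/-- In characteristic `r`, Newton's identities express each power sum as a linear combination of
products of elementary symmetric polynomials having a factor of degree not divisible by `r`. -/
theorem psum_mem_span_esymmProducts (σ K : Type*) [Fintype σ] [CommRing K] (r : ℕ)
    [CharP K r] {k : ℕ} (hk : 0 < k) :
    psum σ K k ∈ Submodule.span K (esymmProducts σ K r) := by
  induction k using Nat.strong_induction_on with
  | h k ih =>
    rw [psum_eq_mul_esymm_sub_sum σ K k hk]
    refine sub_mem ?_ (sum_mem fun a ha => ?_)
    · rw [mul_assoc]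
      exact neg_one_pow_mul_mem _ _ (natCast_mul_esymm_mem_span_esymmProducts σ K r hk)
    · obtain ⟨hsum, hlo, hhi⟩ := Finset.mem_filter.1 ha
      rw [Finset.HasAntidiagonal.mem_antidiagonal] at hsum
      rw [mul_assoc]
      exact neg_one_pow_mul_mem _ _
        (esymm_mul_mem_span_esymmProducts hlo (ih a.2 (by omega) (by omega)))

/-- For a field `K` of positive characteristic `r`, the `K`-subalgebra of `K[x_1, …, x_n]`
generated by all power sums `p_k`, `k ≥ 1`, is contained in the `K`-subalgebra `E` generated by
the products `e_λ = e_{k_1} ⋯ e_{k_l}` over partitions `λ` (multisets of positive integers)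
having at least one part not divisible by `r`. -/
theorem stmt12 (K : Type*) [Field K] (r : ℕ) (hr : 0 < r) [CharP K r] (n : ℕ) (hn : 1 ≤ n) :
    Algebra.adjoin K ((fun k => psum (Fin n) K k) '' (Set.Ici 1)) ≤
      Algebra.adjoin K
        {f : MvPolynomial (Fin n) K | ∃ μ : Multiset ℕ,
          (∀ k ∈ μ, 0 < k) ∧ (∃ k ∈ μ, ¬ r ∣ k) ∧
          f = (μ.map (esymm (Fin n) K)).prod} := by
  refine Algebra.adjoin_le ?_
  rintro _ ⟨k, hk, rfl⟩
  exact Algebra.span_le_adjoin K _ (psum_mem_span_esymmProducts (Fin n) K r hk)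
end

section
/- Let K be a field of positive characteristic r, let k ≥ 1 be an integer not divisible by r, and let the number of variables satisfy n ≥ r. Then the K-subalgebra of K[x_1,…,x_n] generated by p_1,…,p_{k−1} is strictly contained in the K-subalgebra generated by p_1,…,p_k. -/
open MvPolynomial

/-- The elementary symmetric polynomials `e_1, …, e_n` in `n` variables can be sent to arbitrary
elements of a commutative algebra. -/
lemma exists_algHom_symmetricSubalgebra_esymm {K A : Type*} [CommRing K] [CommRing A] [Algebra K A]
    (n : ℕ) (f : ℕ → A) (hf0 : f 0 = 1) (hfn : ∀ a, n < a → f a = 0) :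
    ∃ φ : symmetricSubalgebra (Fin n) K →ₐ[K] A,
      ∀ a, φ ⟨esymm (Fin n) K a, esymm_isSymmetric _ _ a⟩ = f a := by
  refine ⟨(aeval fun i : Fin n => f (i + 1)).comp
    (esymmAlgEquiv (Fin n) K (Fintype.card_fin n)).symm.toAlgHom, fun a => ?_⟩
  rcases Nat.eq_zero_or_pos a with rfl | ha
  · have : (⟨esymm (Fin n) K 0, esymm_isSymmetric _ _ 0⟩ : symmetricSubalgebra (Fin n) K) = 1 :=
      Subtype.ext (by simp)
    rw [this, map_one, hf0]
  · rcases lt_or_ge n a with hna | hna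
    · have : (⟨esymm (Fin n) K a, esymm_isSymmetric _ _ a⟩ : symmetricSubalgebra (Fin n) K) = 0 :=
        Subtype.ext (by
          have : Finset.powersetCard a (Finset.univ : Finset (Fin n)) = ∅ :=
            Finset.powersetCard_eq_empty.2 (by simpa using hna)
          simp [esymm, this])
      rw [this, map_zero, hfn a hna]
    · obtain ⟨i, rfl⟩ : ∃ i : Fin n, a = i + 1 := ⟨⟨a - 1, by omega⟩, by simp; omega⟩
      have := esymmAlgEquiv_symm_apply K (Fintype.card_fin n) i
      simp [this]

/-- Newton's identities inside the algebra of symmetric polynomials. -/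
lemma map_psum_eq_mul_esymm_sub_sum {K A : Type*} [CommRing K] [CommRing A] [Algebra K A]
    {n : ℕ} (φ : symmetricSubalgebra (Fin n) K →ₐ[K] A) {j : ℕ} (hj : 0 < j) :
    φ ⟨psum (Fin n) K j, psum_isSymmetric _ _ j⟩ =
      (-1) ^ (j + 1) * j * φ ⟨esymm (Fin n) K j, esymm_isSymmetric _ _ j⟩ -
        ∑ a ∈ Finset.HasAntidiagonal.antidiagonal j with a.1 ∈ Set.Ioo 0 j,
          (-1) ^ a.1 * φ ⟨esymm (Fin n) K a.1, esymm_isSymmetric _ _ a.1⟩ *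
            φ ⟨psum (Fin n) K a.2, psum_isSymmetric _ _ a.2⟩ := by
  have h : (⟨psum (Fin n) K j, psum_isSymmetric _ _ j⟩ : symmetricSubalgebra (Fin n) K) =
      (-1) ^ (j + 1) * j * ⟨esymm (Fin n) K j, esymm_isSymmetric _ _ j⟩ -
        ∑ a ∈ Finset.HasAntidiagonal.antidiagonal j with a.1 ∈ Set.Ioo 0 j,
          (-1) ^ a.1 * ⟨esymm (Fin n) K a.1, esymm_isSymmetric _ _ a.1⟩ *
            ⟨psum (Fin n) K a.2, psum_isSymmetric _ _ a.2⟩ := by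
    apply Subtype.ext
    simpa using psum_eq_mul_esymm_sub_sum (Fin n) K j hj
  simpa using congrArg φ h

/-- If `e_m ↦ ε`, `e_r ↦ x` and all other elementary symmetric functions vanish, where `0 < m < r`,
`r = 0` and `ε ^ 2 = 0`, then Newton's identities give `p_j = ± m (± x) ^ q ε` for `j = r q + m`
and `p_j = 0` for all other `j > 0`. -/
lemma newton_recurrence_solution {A : Type*} [CommRing A] {r m : ℕ} (hr : (r : A) = 0)
    (hm : 0 < m) (hmr : m < r) {x ε : A} (hε : ε * ε = 0) {e p : ℕ → A}
    (he : ∀ a, 0 < a → e a = if a = m then ε else if a = r then x else 0)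
    (hp : ∀ j, 0 < j → p j = (-1) ^ (j + 1) * j * e j -
      ∑ a ∈ Finset.HasAntidiagonal.antidiagonal j with a.1 ∈ Set.Ioo 0 j, (-1) ^ a.1 * e a.1 * p a.2)
    {j : ℕ} (hj : 0 < j) :
    p j = if j % r = m then (-1) ^ (m + 1) * m * (-(-1) ^ r * x) ^ (j / r) * ε else 0 := by
  induction j using Nat.strong_induction_on with
  | _ j ih =>
  have hεp : ∀ i, 0 < i → i < j → ε * p i = 0 := by
    intro i hi hij
    rw [ih i hij hi]
    split_ifs
    · linear_combination ((-1) ^ (m + 1) * m * (-(-1) ^ r * x) ^ (i / r)) * hε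
    · simp
  have hterm : ∀ a ∈ {a ∈ Finset.HasAntidiagonal.antidiagonal j | a.1 ∈ Set.Ioo 0 j}, a ≠ (r, j - r) →
      (-1) ^ a.1 * e a.1 * p a.2 = 0 := by
    rintro ⟨a, b⟩ hab hne
    simp only [Finset.mem_filter, Finset.HasAntidiagonal.mem_antidiagonal, Set.mem_Ioo] at hab
    have har : a ≠ r := by
      rintro rfl
      exact hne (by ext <;> simp; omega)
    dsimp only
    rw [he a hab.2.1, if_neg har]
    split_ifs
    · rw [mul_assoc, hεp b (by omega) (by omega), mul_zero]
    · simp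
  rw [hp j hj, he j hj]
  rcases lt_trichotomy j r with hjr | rfl | hjr
  · rw [Finset.sum_eq_zero fun a ha => hterm a ha ?_, Nat.mod_eq_of_lt hjr,
      Nat.div_eq_of_lt hjr, if_neg hjr.ne]
    · split_ifs with h
      · subst h; simp
      · simp
    · rintro rfl
      simp at ha
      omega
  · rw [Finset.sum_eq_zero fun a ha => hterm a ha ?_]
    · simp [hr, hm.ne]
    · rintro rfl
      simp at ha
  · rw [Finset.sum_eq_single_of_mem (r, j - r)
      (by simp; omega) hterm, if_neg (by omega), if_neg (by omega)]
    dsimp only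
    rw [he r (by omega), if_neg (by omega), if_pos rfl, ih (j - r) (by omega) (by omega),
      ← Nat.mod_eq_sub_mod hjr.le, Nat.div_eq_sub_div (by omega) hjr.le]
    split_ifs
    · ring
    · simp

/-- The dual numbers over `K[X]` with constant real part and `ε`-part of degree less than `q`. -/
def dualNumberDegreeLT (K : Type*) [Field K] (q : ℕ) :
    Subalgebra K (DualNumber (Polynomial K)) where
  carrier := {z | (∃ c : K, z.fst = Polynomial.C c) ∧ z.snd ∈ Polynomial.degreeLT K q}
  mul_mem' := by
    rintro a b ⟨⟨c, hc⟩, ha⟩ ⟨⟨d, hd⟩, hb⟩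
    refine ⟨⟨c * d, by simp [hc, hd]⟩, ?_⟩
    have : (a * b).snd = c • b.snd + d • a.snd := by
      simp [hc, hd, Polynomial.smul_eq_C_mul, mul_comm]
    rw [this]
    exact add_mem (Submodule.smul_mem _ _ hb) (Submodule.smul_mem _ _ ha)
  add_mem' := by
    rintro a b ⟨⟨c, hc⟩, ha⟩ ⟨⟨d, hd⟩, hb⟩
    exact ⟨⟨c + d, by simp [hc, hd]⟩, by simpa using add_mem ha hb⟩
  algebraMap_mem' c := ⟨⟨c, rfl⟩, zero_mem (Polynomial.degreeLT K q)⟩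

lemma C_mul_C_mul_X_pow_smul_eps_mem_dualNumberDegreeLT {K : Type*} [Field K] {c d : K}
    (hc : c ≠ 0) (hd : d ≠ 0) {i q : ℕ} :
    (TrivSqZeroExt.inr (Polynomial.C c * (Polynomial.C d * Polynomial.X) ^ i) :
      DualNumber (Polynomial K)) ∈ dualNumberDegreeLT K q ↔ i < q := by
  have hdeg : (Polynomial.C c * (Polynomial.C d * Polynomial.X) ^ i).degree = (i : WithBot ℕ) := by
    rw [mul_pow, ← mul_assoc, ← Polynomial.C_pow, ← Polynomial.C_mul,
      Polynomial.degree_C_mul_X_pow i (mul_ne_zero hc (pow_ne_zero i hd))]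
  change ((∃ c : K, _) ∧ _ ∈ Polynomial.degreeLT K q) ↔ _
  rw [Polynomial.mem_degreeLT, TrivSqZeroExt.snd_inr, hdeg, Nat.cast_lt]
  exact and_iff_right ⟨0, by simp⟩

/-- For a field `K` of positive characteristic `r`, an integer `k ≥ 1` not divisible by `r`, and
`n ≥ r` variables, the `K`-subalgebra of `K[x_1, …, x_n]` generated by `p_1, …, p_{k-1}` is
strictly contained in the `K`-subalgebra generated by `p_1, …, p_k`. -/
theorem stmt13 (K : Type*) [Field K] (r : ℕ) (hr : 0 < r) [CharP K r] (k : ℕ) (hk : 1 ≤ k)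
    (hrk : ¬ r ∣ k) (n : ℕ) (hn : r ≤ n) :
    Algebra.adjoin K ((fun j => psum (Fin n) K j) '' (Set.Icc 1 (k - 1))) <
      Algebra.adjoin K ((fun j => psum (Fin n) K j) '' (Set.Icc 1 k)) := by
  refine lt_of_le_not_ge (Algebra.adjoin_mono
    (Set.image_mono (Set.Icc_subset_Icc_right (Nat.sub_le k 1)))) fun hle => ?_
  have hpk := hle (Algebra.subset_adjoin ⟨k, ⟨hk, le_rfl⟩, rfl⟩)
  set m := k % r with hmdef
  have hm : 0 < m := Nat.pos_of_ne_zero fun h => hrk (Nat.dvd_of_mod_eq_zero h)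
  have hmr : m < r := Nat.mod_lt k hr
  have hmK : (m : K) ≠ 0 := fun h =>
    absurd (Nat.le_of_dvd hm ((CharP.cast_eq_zero_iff K r m).1 h)) (by omega)
  let x : DualNumber (Polynomial K) := TrivSqZeroExt.inl Polynomial.X
  obtain ⟨φ, hφ⟩ := exists_algHom_symmetricSubalgebra_esymm (K := K) n
    (fun a => if a = 0 then 1 else if a = m then DualNumber.eps else if a = r then x else 0)
    (by simp) (fun a ha => by
      rw [if_neg (by omega), if_neg (by omega), if_neg (by omega)])
  have hrA : (r : DualNumber (Polynomial K)) = 0 := by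
    rw [← map_natCast (algebraMap K _), CharP.cast_eq_zero, map_zero]
  have hφp : ∀ j, 0 < j → φ ⟨psum (Fin n) K j, psum_isSymmetric _ _ j⟩ =
      if j % r = m then TrivSqZeroExt.inr (Polynomial.C ((-1) ^ (m + 1) * m : K) *
        (Polynomial.C (-(-1) ^ r : K) * Polynomial.X) ^ (j / r)) else 0 := by
    intro j hj
    rw [newton_recurrence_solution (x := x) (ε := DualNumber.eps)
      (e := fun a => φ ⟨esymm (Fin n) K a, esymm_isSymmetric _ _ a⟩)
      (p := fun j => φ ⟨psum (Fin n) K j, psum_isSymmetric _ _ j⟩) hrA hm hmr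
      DualNumber.eps_mul_eps (fun a ha => by rw [hφ, if_neg ha.ne'])
      (fun j hj => map_psum_eq_mul_esymm_sub_sum φ hj) hj]
    refine if_congr Iff.rfl ?_ rfl
    rw [← mul_one (Polynomial.C _ * _), ← smul_eq_mul _ (1 : Polynomial K),
      ← TrivSqZeroExt.inl_mul_inr]
    have hinl : ∀ c : Polynomial K, (TrivSqZeroExt.inl c : DualNumber (Polynomial K)) =
      TrivSqZeroExt.inlHom (Polynomial K) (Polynomial K) c := fun _ => rfl
    simp only [x, DualNumber.eps, hinl, map_mul, map_pow, map_neg, map_one, map_natCast]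
  have hc : ((-1) ^ (m + 1) * m : K) ≠ 0 := by simp [hmK]
  have hd : (-(-1) ^ r : K) ≠ 0 := by simp
  have hadj : Algebra.adjoin K ((fun j => psum (Fin n) K j) '' (Set.Icc 1 (k - 1))) ≤
      ((dualNumberDegreeLT K (k / r)).comap φ).map (symmetricSubalgebra (Fin n) K).val := by
    refine Algebra.adjoin_le ?_
    rintro _ ⟨j, ⟨hj1, hjk⟩, rfl⟩
    refine ⟨⟨psum (Fin n) K j, psum_isSymmetric _ _ j⟩, ?_, rfl⟩
    change φ _ ∈ dualNumberDegreeLT K (k / r)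
    rw [hφp j hj1]
    split_ifs with h
    · rw [C_mul_C_mul_X_pow_smul_eps_mem_dualNumberDegreeLT hc hd]
      have h1 := Nat.div_add_mod j r
      have h2 := Nat.div_add_mod k r
      exact lt_of_mul_lt_mul_left (a := r) (by omega) (Nat.zero_le r)
    · exact zero_mem _
  obtain ⟨y, hy, hyk⟩ := hadj hpk
  obtain rfl : y = ⟨psum (Fin n) K k, psum_isSymmetric _ _ k⟩ := Subtype.ext hyk
  change φ _ ∈ dualNumberDegreeLT K (k / r) at hy
  rw [hφp k hk, if_pos hmdef.symm, C_mul_C_mul_X_pow_smul_eps_mem_dualNumberDegreeLT hc hd] at hy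
  exact lt_irrefl _ hy
end

section
/- Let K be a field of positive characteristic r and let the number of variables satisfy n ≥ r. Then the K-subalgebra of K[x_1,…,x_n] generated by all power sum polynomials p_k, k ≥ 1, is not finitely generated as a K-algebra. -/
open MvPolynomial

/-- The tangent vector in direction `x_0` along the line `(t, …, t, 0, …, 0)` whose first `r`
coordinates are `t`, as an algebra map into the dual numbers over `K[t]`. -/
noncomputable def lineTangent (K : Type*) [Field K] (r n : ℕ) :
    MvPolynomial (Fin n) K →ₐ[K] DualNumber (Polynomial K) :=
  aeval fun i : Fin n =>
    (TrivSqZeroExt.inl (if (i : ℕ) < r then Polynomial.X else 0) +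
      TrivSqZeroExt.inr (if (i : ℕ) = 0 then 1 else 0) : DualNumber (Polynomial K))

theorem fst_lineTangent_psum (K : Type*) [Field K] (r : ℕ) [CharP K r] (n : ℕ) (hn : r ≤ n)
    {k : ℕ} (hk : 1 ≤ k) : (lineTangent K r n (psum (Fin n) K k)).fst = 0 := by
  have hk0 : k ≠ 0 := by lia
  simp only [lineTangent, psum, map_sum, map_pow, aeval_X, TrivSqZeroExt.fst_sum,
    TrivSqZeroExt.fst_pow, TrivSqZeroExt.fst_add, TrivSqZeroExt.fst_inl, TrivSqZeroExt.fst_inr,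
    add_zero, ite_pow, zero_pow hk0]
  rw [← Finset.sum_filter, Finset.sum_const, Fin.card_filter_val_lt, min_eq_right hn,
    nsmul_eq_mul, CharP.cast_eq_zero, zero_mul]

theorem snd_lineTangent_psum (K : Type*) [Field K] (r : ℕ) (hr : 0 < r) (n : ℕ) (hn : r ≤ n)
    (k : ℕ) : (lineTangent K r n (psum (Fin n) K k)).snd = k • Polynomial.X ^ (k - 1) := by
  have : NeZero n := ⟨by lia⟩
  simp only [lineTangent, psum, map_sum, map_pow, aeval_X, TrivSqZeroExt.snd_sum,
    TrivSqZeroExt.snd_pow]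
  rw [Finset.sum_eq_single (0 : Fin n)]
  · simp [hr]
  · intro i _ hi
    simp [Fin.val_eq_zero_iff, hi]
  · simp

/-- A bound on the degree of the tangent part passes from generators to the generated algebra,
provided that the generators are constant along the line. -/
theorem natDegree_snd_le_of_mem_adjoin {K R : Type*} [Field K] [CommRing R] [Algebra K R]
    (φ : R →ₐ[K] DualNumber (Polynomial K)) {s : Set R} {N : ℕ}
    (hs : ∀ f ∈ s, (∃ c, (φ f).fst = Polynomial.C c) ∧ (φ f).snd.natDegree ≤ N)
    {f : R} (hf : f ∈ Algebra.adjoin K s) :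
    (∃ c, (φ f).fst = Polynomial.C c) ∧ (φ f).snd.natDegree ≤ N := by
  induction hf using Algebra.adjoin_induction with
  | mem f hf => exact hs f hf
  | algebraMap c =>
    rw [AlgHom.commutes]
    exact ⟨⟨c, rfl⟩, by simp [TrivSqZeroExt.algebraMap_eq_inl']⟩
  | add f g _ _ hf hg =>
    obtain ⟨⟨a, ha⟩, hf⟩ := hf
    obtain ⟨⟨b, hb⟩, hg⟩ := hg
    refine ⟨⟨a + b, by simp [ha, hb]⟩, ?_⟩
    rw [map_add, TrivSqZeroExt.snd_add]
    exact Polynomial.natDegree_add_le_of_degree_le hf hg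
  | mul f g _ _ hf hg =>
    obtain ⟨⟨a, ha⟩, hf⟩ := hf
    obtain ⟨⟨b, hb⟩, hg⟩ := hg
    refine ⟨⟨a * b, by simp [ha, hb]⟩, ?_⟩
    rw [map_mul, TrivSqZeroExt.snd_mul, ha, hb, op_smul_eq_smul, smul_eq_mul, smul_eq_mul]
    exact Polynomial.natDegree_add_le_of_degree_le
      ((Polynomial.natDegree_C_mul_le _ _).trans hg)
      ((Polynomial.natDegree_C_mul_le _ _).trans hf)

/-- For a field `K` of positive characteristic `r` and `n ≥ r` variables, the `K`-subalgebra of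
`K[x_1, …, x_n]` generated by all power sums `p_k`, `k ≥ 1`, is not finitely generated. -/
theorem stmt14 (K : Type*) [Field K] (r : ℕ) (hr : 0 < r) [CharP K r] (n : ℕ) (hn : r ≤ n) :
    ¬ (Algebra.adjoin K ((fun k => psum (Fin n) K k) '' (Set.Ici 1))).FG := by
  rintro ⟨s, hs⟩
  have constant : ∀ f ∈ Algebra.adjoin K ((fun k => psum (Fin n) K k) '' (Set.Ici 1)),
      ∃ c, (lineTangent K r n f).fst = Polynomial.C c := by
    intro f hf
    induction hf using Algebra.adjoin_induction with
    | mem f hf =>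
      obtain ⟨k, hk, rfl⟩ := hf
      exact ⟨0, by simpa using fst_lineTangent_psum K r n hn hk⟩
    | algebraMap c => exact ⟨c, by rw [AlgHom.commutes]; rfl⟩
    | add f g _ _ hf hg =>
      obtain ⟨a, ha⟩ := hf
      obtain ⟨b, hb⟩ := hg
      exact ⟨a + b, by simp [ha, hb]⟩
    | mul f g _ _ hf hg =>
      obtain ⟨a, ha⟩ := hf
      obtain ⟨b, hb⟩ := hg
      exact ⟨a * b, by simp [ha, hb]⟩
  let N := s.sup fun f => (lineTangent K r n f).snd.natDegree
  have hmem : psum (Fin n) K (r * (N + 1) + 1) ∈ Algebra.adjoin K (s : Set _) := by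
    rw [hs]
    exact Algebra.subset_adjoin ⟨_, Set.mem_Ici.2 (by lia), rfl⟩
  have hdeg := (natDegree_snd_le_of_mem_adjoin (lineTangent K r n) (N := N) (fun f hf =>
    ⟨constant f (hs ▸ Algebra.subset_adjoin hf),
      Finset.le_sup (f := fun f => (lineTangent K r n f).snd.natDegree) hf⟩) hmem).2
  rw [snd_lineTangent_psum K r hr n hn] at hdeg
  simp at hdeg
  nlinarith
end

section
/- Work in the polynomial ring F_2[x_1,x_2] in two variables over the field with two elements. For every m ≥ 0, the F_2-subalgebra generated by the odd power sums p_1, p_3, …, p_{2m+1} equals the F_2-subalgebra generated by the elements e_1, e_1·e_2, e_1·e_2^2, …, e_1·e_2^m. -/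
open MvPolynomial

section CharTwo

variable {R : Type*} [CommRing R] [CharP R 2] (x y : R)

/-- In characteristic two, an odd power sum of two elements expands in the products `e₁ * e₂ ^ i`
with squares of power sums as coefficients. -/
theorem odd_pow_add_pow_eq_sum (j : ℕ) :
    x ^ (2 * j + 1) + y ^ (2 * j + 1) = (x + y) * (x * y) ^ j +
      ∑ i ∈ Finset.range j, (x + y) * (x * y) ^ (j - 1 - i) * (x ^ (i + 1) + y ^ (i + 1)) ^ 2 := by
  induction j with
  | zero => simp
  | succ j ih =>
    have hshift : ∑ i ∈ Finset.range j,
        (x + y) * (x * y) ^ (j - i) * (x ^ (i + 1) + y ^ (i + 1)) ^ 2 = x * y *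
          ∑ i ∈ Finset.range j,
            (x + y) * (x * y) ^ (j - 1 - i) * (x ^ (i + 1) + y ^ (i + 1)) ^ 2 := by
      rw [Finset.mul_sum]
      refine Finset.sum_congr rfl fun i hi => ?_
      rw [Finset.mem_range] at hi
      rw [show j - i = j - 1 - i + 1 by omega, pow_succ]
      ring
    have hstep : x ^ (2 * (j + 1) + 1) + y ^ (2 * (j + 1) + 1) =
        x * y * (x ^ (2 * j + 1) + y ^ (2 * j + 1)) +
          (x + y) * (x ^ (j + 1) + y ^ (j + 1)) ^ 2 := by
      rw [CharTwo.add_sq]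
      linear_combination (-x * y * (x ^ (2 * j + 1) + y ^ (2 * j + 1))) *
        CharTwo.two_eq_zero (R := R)
    rw [Finset.sum_range_succ, Nat.add_sub_cancel, hshift, hstep, ih]
    simp only [Nat.sub_self, pow_zero]
    ring

variable {x y} {S : Type*} [SetLike S R] [SubringClass S R] {A : S}

theorem pow_add_pow_mem_of_odd {j : ℕ}
    (h : ∀ i < j, x ^ (2 * i + 1) + y ^ (2 * i + 1) ∈ A) {k : ℕ} (hk : k < j) :
    x ^ (k + 1) + y ^ (k + 1) ∈ A := by
  induction k using Nat.strong_induction_on with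
  | _ k ih =>
    obtain ⟨l, rfl | rfl⟩ := Nat.even_or_odd' k
    · exact h l (by omega)
    · rw [show 2 * l + 1 + 1 = (l + 1) * 2 by ring, pow_mul, pow_mul, ← CharTwo.add_sq]
      exact pow_mem (ih l (by omega) (by omega)) 2

theorem odd_pow_add_pow_mem_iff_of_lt {j : ℕ}
    (hp : ∀ i < j, x ^ (2 * i + 1) + y ^ (2 * i + 1) ∈ A)
    (he : ∀ i < j, (x + y) * (x * y) ^ i ∈ A) :
    x ^ (2 * j + 1) + y ^ (2 * j + 1) ∈ A ↔ (x + y) * (x * y) ^ j ∈ A := by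
  rw [odd_pow_add_pow_eq_sum]
  refine add_mem_cancel_right (sum_mem fun i hi => ?_)
  rw [Finset.mem_range] at hi
  exact mul_mem (he _ (by omega)) (pow_mem (pow_add_pow_mem_of_odd hp hi) 2)

theorem forall_odd_pow_add_pow_mem_iff (m : ℕ) :
    (∀ j ≤ m, x ^ (2 * j + 1) + y ^ (2 * j + 1) ∈ A) ↔
      ∀ j ≤ m, (x + y) * (x * y) ^ j ∈ A := by
  constructor <;> intro h j <;> induction j using Nat.strong_induction_on with
  | _ j ih => ?_
  · exact fun hj => (odd_pow_add_pow_mem_iff_of_lt (fun i hi => h i (by omega))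
      fun i hi => ih i hi (by omega)).1 (h j hj)
  · exact fun hj => (odd_pow_add_pow_mem_iff_of_lt (fun i hi => ih i hi (by omega))
      fun i hi => h i (by omega)).2 (h j hj)

end CharTwo

theorem psum_fin_two (R : Type*) [CommSemiring R] (n : ℕ) :
    psum (Fin 2) R n = X 0 ^ n + X 1 ^ n := by
  simp [psum]

theorem esymm_fin_two_two (R : Type*) [CommSemiring R] :
    esymm (Fin 2) R 2 = X 0 * X 1 := by
  have hcard : Finset.powersetCard 2 (Finset.univ : Finset (Fin 2)) = {Finset.univ} :=
    Finset.powersetCard_self _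
  simp [esymm, hcard]

/-- In `𝔽₂[x_1, x_2]`, for every `m ≥ 0`, the `𝔽₂`-subalgebra generated by the odd power sums
`p_1, p_3, …, p_{2m+1}` equals the `𝔽₂`-subalgebra generated by `e_1, e_1·e_2, …, e_1·e_2^m`. -/
theorem stmt15 (m : ℕ) :
    Algebra.adjoin (ZMod 2)
        ((fun j => psum (Fin 2) (ZMod 2) (2 * j + 1)) '' (Set.Iic m)) =
      Algebra.adjoin (ZMod 2)
        ((fun j => esymm (Fin 2) (ZMod 2) 1 * esymm (Fin 2) (ZMod 2) 2 ^ j) '' (Set.Iic m)) := by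
  refine eq_of_forall_ge_iff fun A => ?_
  simp only [Algebra.adjoin_le_iff, Set.image_subset_iff, psum_fin_two, esymm_fin_two_two,
    esymm_one, Fin.sum_univ_two]
  exact forall_odd_pow_add_pow_mem_iff (A := A) m
end

section
/- Work in the polynomial ring F_2[x_1,x_2,x_3] in three variables over the field with two elements. The elementary symmetric polynomial e_3 = x_1·x_2·x_3 does not lie in the F_2-subalgebra generated by all power sum polynomials p_k, k ≥ 1. -/
open MvPolynomial

/-- In `𝔽₂[x_1, x_2, x_3]`, the elementary symmetric polynomial `e_3 = x_1 x_2 x_3` does not lie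
in the `𝔽₂`-subalgebra generated by all power sums `p_k`, `k ≥ 1`. -/
theorem stmt16 :
    esymm (Fin 3) (ZMod 2) 3 ∉
      Algebra.adjoin (ZMod 2) ((fun k => psum (Fin 3) (ZMod 2) k) '' (Set.Ici 1)) := by
  intro h
  -- The power sums of positive degree do not separate the points `(1, 1, 1)` and `(0, 0, 1)`.
  have hle := AlgHom.adjoin_le_equalizer
    (aeval (R := ZMod 2) (![1, 1, 1] : Fin 3 → ZMod 2)) (aeval ![0, 0, 1])
    (s := (fun k => psum (Fin 3) (ZMod 2) k) '' (Set.Ici 1)) (by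
      rintro _ ⟨k, hk, rfl⟩
      have hk0 : k ≠ 0 := Nat.one_le_iff_ne_zero.mp hk
      simp [psum, Fin.sum_univ_three, hk0]
      decide)
  have heq := hle h
  have hcard : Finset.powersetCard 3 (Finset.univ : Finset (Fin 3)) = {Finset.univ} := by decide
  simp [AlgHom.mem_equalizer, esymm, hcard, Fin.prod_univ_three] at heq
end
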